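/- arXiv:2012.11457 — 2 statements merged into one kernel-verified Lean document; each statement's English description precedes it below -/
import Mathlib

section
/- Let U ⊆ ℂⁿ be open and φ ∈ C^∞(U, ℝ). For all u, v ∈ C_c^∞(U × ℝ, ℂ) one has Σ_{j=1}^n ∫_{U×ℝ} (Z̄_j u)(z,x) · conj((Z̄_j v)(z,x)) dλ(z) dx = (1/2π) ∫_ℝ Σ_{j=1}^n ∫_U ∂/∂z̄_j( e^{tφ} û(·,t) )(z) · conj( ∂/∂z̄_j( e^{tφ} v̂(·,t) )(z) ) e^{−2tφ(z)} dλ(z) dt, i.e. (∂̄_b u | ∂̄_b v)_{L²(U×ℝ)} = (1/2π) ∫_ℝ ⟨ ∂̄( e^{tφ} û(·,t) ), ∂̄( e^{tφ} v̂(·,t) ) ⟩_{L²(U, e^{−2tφ})} dt. -/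
/-!
STATEMENT 6: Parseval-type energy identity on a BRT chart:
`(∂̄_b u | ∂̄_b v)_{L²(U×ℝ)} = (1/2π) ∫_ℝ ⟨∂̄(e^{tφ}û(·,t)), ∂̄(e^{tφ}v̂(·,t))⟩_{L²(U,e^{−2tφ})} dt`.
-/

open MeasureTheory

noncomputable section

/-- The Wirtinger derivative `∂f/∂z_j` of `f : ℂⁿ → ℂ` at `z`. -/
def wirtZ {n : ℕ} (f : (Fin n → ℂ) → ℂ) (j : Fin n) (z : Fin n → ℂ) : ℂ :=
  (1 / 2 : ℂ) * (lineDeriv ℝ f z (Pi.single j 1)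
    - Complex.I * lineDeriv ℝ f z (Pi.single j Complex.I))

/-- The Wirtinger derivative `∂f/∂z̄_j` of `f : ℂⁿ → ℂ` at `z`. -/
def wirtZbar {n : ℕ} (f : (Fin n → ℂ) → ℂ) (j : Fin n) (z : Fin n → ℂ) : ℂ :=
  (1 / 2 : ℂ) * (lineDeriv ℝ f z (Pi.single j 1)
    + Complex.I * lineDeriv ℝ f z (Pi.single j Complex.I))

/-- `∂φ/∂z_j` for a real-valued `φ`. -/
def wirtZR {n : ℕ} (φ : (Fin n → ℂ) → ℝ) (j : Fin n) (z : Fin n → ℂ) : ℂ :=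
  wirtZ (fun w => (φ w : ℂ)) j z

/-- `∂φ/∂z̄_j` for a real-valued `φ`. -/
def wirtZbarR {n : ℕ} (φ : (Fin n → ℂ) → ℝ) (j : Fin n) (z : Fin n → ℂ) : ℂ :=
  wirtZbar (fun w => (φ w : ℂ)) j z

/-- The derivative `∂u/∂x` in the real variable of `u : ℂⁿ × ℝ → ℂ`. -/
def dX {n : ℕ} (u : (Fin n → ℂ) × ℝ → ℂ) (p : (Fin n → ℂ) × ℝ) : ℂ :=
  deriv (fun s => u (p.1, s)) p.2

/-- The CR vector field `Z̄_j = ∂/∂z̄_j − i (∂φ/∂z̄_j) ∂/∂x` acting on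
`u : ℂⁿ × ℝ → ℂ`. -/
def Zbar {n : ℕ} (φ : (Fin n → ℂ) → ℝ) (j : Fin n) (u : (Fin n → ℂ) × ℝ → ℂ) :
    (Fin n → ℂ) × ℝ → ℂ :=
  fun p => wirtZbar (fun w => u (w, p.2)) j p.1
    - Complex.I * wirtZbarR φ j p.1 * dX u p

/-- The vector field `Z_j = ∂/∂z_j + i (∂φ/∂z_j) ∂/∂x` acting on
`u : ℂⁿ × ℝ → ℂ`. -/
def Zorig {n : ℕ} (φ : (Fin n → ℂ) → ℝ) (j : Fin n) (u : (Fin n → ℂ) × ℝ → ℂ) :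
    (Fin n → ℂ) × ℝ → ℂ :=
  fun p => wirtZ (fun w => u (w, p.2)) j p.1
    + Complex.I * wirtZR φ j p.1 * dX u p

/-- Partial Fourier transform in the real variable:
`û(z,t) = ∫_ℝ e^{−itx} u(z,x) dx`. -/
def pft {n : ℕ} (u : (Fin n → ℂ) × ℝ → ℂ) (z : Fin n → ℂ) (t : ℝ) : ℂ :=
  ∫ x : ℝ, Complex.exp (-(Complex.I * t * x)) * u (z, x)

end


open scoped FourierTransform SchwartzMap ComplexConjugate

theorem integral_exp_mul_eq_fourier (f : ℝ → ℂ) (t : ℝ) :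
    ∫ x : ℝ, Complex.exp (-(Complex.I * t * x)) * f x = 𝓕 f (t / (2 * Real.pi)) := by
  rw [Real.fourier_eq']
  refine integral_congr_ae (Filter.Eventually.of_forall fun x => ?_)
  simp only [smul_eq_mul, RCLike.inner_apply, conj_trivial]
  congr 2
  have : (Real.pi : ℂ) ≠ 0 := by exact_mod_cast Real.pi_ne_zero
  push_cast
  field_simp

/-- Parseval's formula for `f̂(t) = ∫ e^{-itx} f(x) dx` on test functions. -/
theorem parseval_of_hasCompactSupport {f g : ℝ → ℂ} (hf : ContDiff ℝ (⊤ : ℕ∞) f)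
    (hfc : HasCompactSupport f) (hg : ContDiff ℝ (⊤ : ℕ∞) g) (hgc : HasCompactSupport g) :
    Integrable (fun t : ℝ => (∫ x : ℝ, Complex.exp (-(Complex.I * t * x)) * f x) *
        conj (∫ x : ℝ, Complex.exp (-(Complex.I * t * x)) * g x)) ∧
      ∫ t : ℝ, (∫ x : ℝ, Complex.exp (-(Complex.I * t * x)) * f x) *
          conj (∫ x : ℝ, Complex.exp (-(Complex.I * t * x)) * g x)
        = 2 * Real.pi * ∫ x : ℝ, f x * conj (g x) := by
  let F : 𝓢(ℝ, ℂ) := hfc.toSchwartzMap hf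
  let G : 𝓢(ℝ, ℂ) := hgc.toSchwartzMap hg
  have hF (ξ : ℝ) : 𝓕 f ξ = (𝓕 F) ξ := by rw [SchwartzMap.fourier_coe]; rfl
  have hG (ξ : ℝ) : 𝓕 g ξ = (𝓕 G) ξ := by rw [SchwartzMap.fourier_coe]; rfl
  have hpi : (2 * Real.pi) ≠ 0 := by positivity
  simp only [integral_exp_mul_eq_fourier, hF, hG]
  constructor
  · have h : Integrable (fun ξ : ℝ => (𝓕 F) ξ * conj ((𝓕 G) ξ)) := by
      refine (𝓕 F).integrable.mul_bdd (c := ‖(𝓕 G).toBoundedContinuousFunction‖) ?_ ?_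
      · exact (Complex.continuous_conj.comp (𝓕 G).continuous).aestronglyMeasurable
      · refine Filter.Eventually.of_forall fun x => ?_
        rw [RCLike.norm_conj]
        exact (𝓕 G).toBoundedContinuousFunction.norm_coe_le_norm x
    exact h.comp_div hpi
  · refine (Measure.integral_comp_div (fun ξ : ℝ => (𝓕 F) ξ * conj ((𝓕 G) ξ)) _).trans ?_
    rw [abs_of_pos (by positivity)]
    have h := SchwartzMap.integral_inner_fourier_fourier G F
    simp only [RCLike.inner_apply] at h
    rw [h, Complex.real_smul]
    push_cast
    rfl

theorem HasCompactSupport.comp_prodMk {E : Type*} [TopologicalSpace E] [T1Space E]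
    {F : E × ℝ → ℂ} (hF : HasCompactSupport F) (z : E) :
    HasCompactSupport (fun x : ℝ => F (z, x)) :=
  hF.comp_isClosedEmbedding (g := fun x : ℝ => (z, x))
    (Topology.IsClosedEmbedding.of_continuous_injective_isClosedMap (by fun_prop)
      (fun a b h => (Prod.ext_iff.1 h).2) (by
        intro s hs
        have : (fun x : ℝ => (z, x)) '' s = {z} ×ˢ s := by ext ⟨a, b⟩; simp [eq_comm, and_comm]
        rw [this]
        exact isClosed_singleton.prod hs))

theorem integral_norm_pft_sq {n : ℕ} {F : (Fin n → ℂ) × ℝ → ℂ} (hFc : HasCompactSupport F)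
    (hFs : ∀ z, ContDiff ℝ (⊤ : ℕ∞) fun x : ℝ => F (z, x)) (z : Fin n → ℂ) :
    Integrable (fun t => ‖pft F z t‖ ^ 2) ∧
      ∫ t, ‖pft F z t‖ ^ 2 = 2 * Real.pi * ∫ x, ‖F (z, x)‖ ^ 2 := by
  obtain ⟨h1, h2⟩ := parseval_of_hasCompactSupport (hFs z) (hFc.comp_prodMk z) (hFs z)
    (hFc.comp_prodMk z)
  simp only [Complex.mul_conj'] at h1 h2
  constructor
  · have := h1.re
    refine this.congr (Filter.Eventually.of_forall fun t => ?_)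
    simp only [pft]
    norm_cast
  · simp only [← Complex.ofReal_pow] at h2
    exact_mod_cast h2

theorem stronglyMeasurable_pft {n : ℕ} {F : (Fin n → ℂ) × ℝ → ℂ} (hF : Continuous F) :
    StronglyMeasurable fun q : (Fin n → ℂ) × ℝ => pft F q.1 q.2 := by
  have : Continuous fun r : ((Fin n → ℂ) × ℝ) × ℝ =>
      Complex.exp (-(Complex.I * r.1.2 * r.2)) * F (r.1.1, r.2) := by fun_prop
  exact this.stronglyMeasurable.integral_prod_right

theorem integrable_pft_mul_conj {n : ℕ} (μ : Measure (Fin n → ℂ)) [SFinite μ]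
    [IsFiniteMeasureOnCompacts μ] {F G : (Fin n → ℂ) × ℝ → ℂ}
    (hF : Continuous F) (hFc : HasCompactSupport F)
    (hFs : ∀ z, ContDiff ℝ (⊤ : ℕ∞) fun x : ℝ => F (z, x))
    (hG : Continuous G) (hGc : HasCompactSupport G)
    (hGs : ∀ z, ContDiff ℝ (⊤ : ℕ∞) fun x : ℝ => G (z, x)) :
    Integrable (fun q : (Fin n → ℂ) × ℝ => pft F q.1 q.2 * conj (pft G q.1 q.2))
      (μ.prod volume) := by
  have hm : StronglyMeasurable
      fun q : (Fin n → ℂ) × ℝ => pft F q.1 q.2 * conj (pft G q.1 q.2) :=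
    (stronglyMeasurable_pft hF).mul
      (Complex.continuous_conj.comp_stronglyMeasurable (stronglyMeasurable_pft hG))
  have hsq {H : (Fin n → ℂ) × ℝ → ℂ} (hH : Continuous H) (hHc : HasCompactSupport H) :
      Integrable (fun z => ∫ x, ‖H (z, x)‖ ^ 2) μ := by
    have hc : HasCompactSupport fun p => ‖H p‖ ^ 2 := hHc.mono fun p hp h => hp (by simp [h])
    have : Integrable (fun p => ‖H p‖ ^ 2) (μ.prod volume) :=
      (hH.norm.pow 2).integrable_of_hasCompactSupport hc
    exact Integrable.integral_prod_left (f := fun p => ‖H p‖ ^ 2) this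
  rw [integrable_prod_iff hm.aestronglyMeasurable]
  refine ⟨Filter.Eventually.of_forall fun z => (parseval_of_hasCompactSupport (hFs z)
    (hFc.comp_prodMk z) (hGs z) (hGc.comp_prodMk z)).1, ?_⟩
  refine Integrable.mono' (((hsq hF hFc).add (hsq hG hGc)).const_mul Real.pi)
    hm.norm.integral_prod_right.aestronglyMeasurable (Filter.Eventually.of_forall fun z => ?_)
  obtain ⟨hF1, hF2⟩ := integral_norm_pft_sq hFc hFs z
  obtain ⟨hG1, hG2⟩ := integral_norm_pft_sq hGc hGs z
  rw [Real.norm_of_nonneg (integral_nonneg fun _ => norm_nonneg _)]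
  calc ∫ t, ‖pft F z t * conj (pft G z t)‖
      ≤ ∫ t, (1 / 2 : ℝ) * (‖pft F z t‖ ^ 2 + ‖pft G z t‖ ^ 2) := by
        refine integral_mono_of_nonneg (Filter.Eventually.of_forall fun _ => norm_nonneg _)
          ((hF1.add hG1).const_mul _) (Filter.Eventually.of_forall fun t => ?_)
        simp only [norm_mul, RCLike.norm_conj]
        nlinarith [sq_nonneg (‖pft F z t‖ - ‖pft G z t‖)]
    _ = Real.pi * ((∫ x, ‖F (z, x)‖ ^ 2) + ∫ x, ‖G (z, x)‖ ^ 2) := by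
        rw [integral_const_mul, integral_add hF1 hG1, hF2, hG2]
        ring

theorem integral_mul_conj_eq_pft {n : ℕ} (μ : Measure (Fin n → ℂ)) [SFinite μ]
    [IsFiniteMeasureOnCompacts μ] {F G : (Fin n → ℂ) × ℝ → ℂ}
    (hF : Continuous F) (hFc : HasCompactSupport F)
    (hFs : ∀ z, ContDiff ℝ (⊤ : ℕ∞) fun x : ℝ => F (z, x))
    (hG : Continuous G) (hGc : HasCompactSupport G)
    (hGs : ∀ z, ContDiff ℝ (⊤ : ℕ∞) fun x : ℝ => G (z, x)) :
    ∫ p, F p * conj (G p) ∂(μ.prod volume)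
      = (1 / (2 * (Real.pi : ℂ))) *
        ∫ t : ℝ, ∫ z, pft F z t * conj (pft G z t) ∂μ := by
  have hFG : Integrable (fun p => F p * conj (G p)) (μ.prod volume) :=
    (hF.mul (Complex.continuous_conj.comp hG)).integrable_of_hasCompactSupport hFc.mul_right
  have hpi : (2 * (Real.pi : ℂ)) ≠ 0 := by exact_mod_cast Real.two_pi_pos.ne'
  rw [← integral_integral_swap (integrable_pft_mul_conj μ hF hFc hFs hG hGc hGs),
    integral_prod _ hFG, ← integral_const_mul]
  refine integral_congr_ae (Filter.Eventually.of_forall fun z => ?_)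
  have := (parseval_of_hasCompactSupport (hFs z)
    (hFc.comp_prodMk z) (hGs z) (hGc.comp_prodMk z)).2
  simp only [pft]
  rw [this, ← mul_assoc, one_div_mul_cancel hpi, one_mul]

theorem hasDerivAt_comp_line {n : ℕ} {u : (Fin n → ℂ) × ℝ → ℂ} (hu : ContDiff ℝ (⊤ : ℕ∞) u)
    (z v : Fin n → ℂ) (x s : ℝ) :
    HasDerivAt (fun s : ℝ => u (z + s • v, x)) (fderiv ℝ u (z + s • v, x) (v, 0)) s := by
  have h1 : HasDerivAt (fun s : ℝ => (z + s • v, x)) (v, (0 : ℝ)) s := by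
    have := ((hasDerivAt_id s).smul_const v).const_add z
    rw [one_smul] at this
    exact this.prodMk (hasDerivAt_const s x)
  exact ((hu.differentiable (by simp)) _).hasFDerivAt.comp_hasDerivAt s h1

theorem hasLineDerivAt_comp_prodMk {n : ℕ} {u : (Fin n → ℂ) × ℝ → ℂ}
    (hu : ContDiff ℝ (⊤ : ℕ∞) u) (z v : Fin n → ℂ) (x : ℝ) :
    HasLineDerivAt ℝ (fun w => u (w, x)) (fderiv ℝ u (z, x) (v, 0)) z v := by
  simpa [HasLineDerivAt] using hasDerivAt_comp_line hu z v x 0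

theorem hasDerivAt_snd {n : ℕ} {u : (Fin n → ℂ) × ℝ → ℂ} (hu : ContDiff ℝ (⊤ : ℕ∞) u)
    (z : Fin n → ℂ) (x : ℝ) :
    HasDerivAt (fun s : ℝ => u (z, s)) (fderiv ℝ u (z, x) (0, 1)) x :=
  ((hu.differentiable (by simp)) _).hasFDerivAt.comp_hasDerivAt x
    ((hasDerivAt_const x z).prodMk (hasDerivAt_id x))

theorem contDiff_fderiv_const {n : ℕ} {u : (Fin n → ℂ) × ℝ → ℂ} (hu : ContDiff ℝ (⊤ : ℕ∞) u)
    (w : (Fin n → ℂ) × ℝ) : ContDiff ℝ (⊤ : ℕ∞) fun p => fderiv ℝ u p w :=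
  (hu.fderiv_right (m := (⊤ : ℕ∞)) (by simp)).clm_apply contDiff_const

theorem integrable_exp_mul {n : ℕ} {F : (Fin n → ℂ) × ℝ → ℂ} (hF : Continuous F)
    (hFc : HasCompactSupport F) (z : Fin n → ℂ) (t : ℝ) :
    Integrable fun x : ℝ => Complex.exp (-(Complex.I * t * x)) * F (z, x) :=
  Continuous.integrable_of_hasCompactSupport (by fun_prop) (hFc.comp_prodMk z).mul_left

theorem norm_exp_neg_I_mul (t x : ℝ) : ‖Complex.exp (-(Complex.I * t * x))‖ = 1 := by
  rw [Complex.norm_exp]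
  simp

theorem hasLineDerivAt_pft {n : ℕ} {u : (Fin n → ℂ) × ℝ → ℂ} (hu : ContDiff ℝ (⊤ : ℕ∞) u)
    (huc : HasCompactSupport u) (z v : Fin n → ℂ) (t : ℝ) :
    HasLineDerivAt ℝ (fun w => pft u w t) (pft (fun p => fderiv ℝ u p (v, 0)) z t) z v := by
  have hD : Continuous fun p => fderiv ℝ u p (v, 0) := (contDiff_fderiv_const hu _).continuous
  have hDc : HasCompactSupport fun p => fderiv ℝ u p (v, 0) := huc.fderiv_apply ℝ _
  obtain ⟨C, hC⟩ := hD.bounded_above_of_compact_support hDc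
  set K : Set ℝ := Prod.snd '' tsupport u
  have hKc : IsCompact K := huc.isCompact.image continuous_snd
  have key := hasDerivAt_integral_of_dominated_loc_of_deriv_le (μ := volume) (x₀ := (0 : ℝ))
    (s := Set.univ) (bound := K.indicator fun _ => C)
    (F := fun s x => Complex.exp (-(Complex.I * t * x)) * u (z + s • v, x))
    (F' := fun s x => Complex.exp (-(Complex.I * t * x)) * fderiv ℝ u (z + s • v, x) (v, 0))
    Filter.univ_mem
    (Filter.Eventually.of_forall fun s =>
      (integrable_exp_mul hu.continuous huc _ t).aestronglyMeasurable)
    (integrable_exp_mul hu.continuous huc _ t)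
    (integrable_exp_mul hD hDc _ t).aestronglyMeasurable
    (Filter.Eventually.of_forall fun x s _ => by
      rw [norm_mul, norm_exp_neg_I_mul, one_mul]
      by_cases hx : x ∈ K
      · simpa [hx] using hC (z + s • v, x)
      · have : (z + s • v, x) ∉ tsupport u := fun h => hx ⟨_, h, rfl⟩
        have h0 : fderiv ℝ u (z + s • v, x) (v, 0) = 0 :=
          image_eq_zero_of_notMem_tsupport (f := fun p => fderiv ℝ u p (v, 0))
            fun h => this (tsupport_fderiv_apply_subset ℝ _ h)
        simp [hx, h0])
    ((integrable_indicator_iff hKc.measurableSet).2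
      (integrableOn_const hKc.measure_lt_top.ne))
    (Filter.Eventually.of_forall fun x s _ => (hasDerivAt_comp_line hu z v x s).const_mul _)
  simpa [HasLineDerivAt, pft] using key.2

theorem pft_fderiv_snd {n : ℕ} {u : (Fin n → ℂ) × ℝ → ℂ} (hu : ContDiff ℝ (⊤ : ℕ∞) u)
    (huc : HasCompactSupport u) (z : Fin n → ℂ) (t : ℝ) :
    pft (fun p => fderiv ℝ u p (0, 1)) z t = Complex.I * t * pft u z t := by
  have hD : Continuous fun p => fderiv ℝ u p (0, 1) := (contDiff_fderiv_const hu _).continuous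
  have hDc : HasCompactSupport fun p => fderiv ℝ u p (0, 1) := huc.fderiv_apply ℝ _
  have hE (x : ℝ) : HasDerivAt (fun x : ℝ => Complex.exp (-(Complex.I * t * x)))
      (-(Complex.I * t) * Complex.exp (-(Complex.I * t * x))) x := by
    have h := (((hasDerivAt_id x).ofReal_comp.const_mul (Complex.I * t)).neg).cexp
    simpa [mul_comm] using h
  have h := integral_mul_deriv_eq_deriv_mul_of_integrable
    (v := fun x : ℝ => u (z, x)) (v' := fun x => fderiv ℝ u (z, x) (0, 1))
    (fun x _ => hE x) (fun x _ => hasDerivAt_snd hu z x)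
    (integrable_exp_mul hD hDc z t)
    (by
      refine ((integrable_exp_mul hu.continuous huc z t).const_mul (-(Complex.I * t))).congr
        (Filter.Eventually.of_forall fun x => ?_)
      simp [mul_assoc])
    (integrable_exp_mul hu.continuous huc z t)
  simp only [pft]
  rw [h]
  simp only [mul_assoc, neg_mul, integral_neg, neg_neg, integral_const_mul]

theorem Zbar_eq_fderiv {n : ℕ} (φ : (Fin n → ℂ) → ℝ) (j : Fin n) {u : (Fin n → ℂ) × ℝ → ℂ}
    (hu : ContDiff ℝ (⊤ : ℕ∞) u) :
    Zbar φ j u = fun p => (1 / 2 : ℂ) * (fderiv ℝ u p (Pi.single j 1, 0)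
        + Complex.I * fderiv ℝ u p (Pi.single j Complex.I, 0))
      - Complex.I * wirtZbarR φ j p.1 * fderiv ℝ u p (0, 1) := by
  ext ⟨z, x⟩
  simp only [Zbar, wirtZbar, dX, (hasLineDerivAt_comp_prodMk hu z _ x).lineDeriv,
    (hasDerivAt_snd hu z x).deriv]

theorem Zbar_eq_zero_of_notMem_tsupport {n : ℕ} (φ : (Fin n → ℂ) → ℝ) (j : Fin n)
    {u : (Fin n → ℂ) × ℝ → ℂ} (hu : ContDiff ℝ (⊤ : ℕ∞) u) {p : (Fin n → ℂ) × ℝ}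
    (hp : p ∉ tsupport u) : Zbar φ j u p = 0 := by
  have h0 : fderiv ℝ u p = 0 :=
    image_eq_zero_of_notMem_tsupport fun h => hp (tsupport_fderiv_subset ℝ h)
  simp [Zbar_eq_fderiv φ j hu, h0]

theorem hasCompactSupport_Zbar {n : ℕ} (φ : (Fin n → ℂ) → ℝ) (j : Fin n)
    {u : (Fin n → ℂ) × ℝ → ℂ} (hu : ContDiff ℝ (⊤ : ℕ∞) u) (huc : HasCompactSupport u) :
    HasCompactSupport (Zbar φ j u) :=
  huc.mono' fun _ hp => by_contra fun h => hp (Zbar_eq_zero_of_notMem_tsupport φ j hu h)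

theorem contDiff_Zbar_snd {n : ℕ} (φ : (Fin n → ℂ) → ℝ) (j : Fin n)
    {u : (Fin n → ℂ) × ℝ → ℂ} (hu : ContDiff ℝ (⊤ : ℕ∞) u) (z : Fin n → ℂ) :
    ContDiff ℝ (⊤ : ℕ∞) fun x : ℝ => Zbar φ j u (z, x) := by
  have h (w) : ContDiff ℝ (⊤ : ℕ∞) fun x : ℝ => fderiv ℝ u (z, x) w :=
    (contDiff_fderiv_const hu w).comp (contDiff_const.prodMk contDiff_id)
  rw [Zbar_eq_fderiv φ j hu]
  exact (contDiff_const.mul ((h _).add (contDiff_const.mul (h _)))).sub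
    ((contDiff_const (c := Complex.I * wirtZbarR φ j z)).mul (h _))

theorem hasLineDerivAt_ofReal_comp {n : ℕ} {U : Set (Fin n → ℂ)} (hU : IsOpen U)
    {φ : (Fin n → ℂ) → ℝ} (hφ : ContDiffOn ℝ (⊤ : ℕ∞) φ U) {z : Fin n → ℂ} (hz : z ∈ U)
    (v : Fin n → ℂ) :
    HasLineDerivAt ℝ (fun w => (φ w : ℂ)) (fderiv ℝ φ z v : ℂ) z v := by
  have h := ((hφ.contDiffAt (hU.mem_nhds hz)).differentiableAt (by simp)).hasFDerivAt
  exact HasDerivAt.ofReal_comp (h.hasLineDerivAt v)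

theorem continuousOn_wirtZbarR {n : ℕ} {U : Set (Fin n → ℂ)} (hU : IsOpen U)
    {φ : (Fin n → ℂ) → ℝ} (hφ : ContDiffOn ℝ (⊤ : ℕ∞) φ U) (j : Fin n) :
    ContinuousOn (wirtZbarR φ j) U := by
  have hc (v) : ContinuousOn (fun z => (fderiv ℝ φ z v : ℂ)) U :=
    Complex.continuous_ofReal.comp_continuousOn
      ((hφ.continuousOn_fderiv_of_isOpen hU (by simp)).clm_apply continuousOn_const)
  refine (continuousOn_const.mul ((hc (Pi.single j 1)).add
    (continuousOn_const.mul (hc (Pi.single j Complex.I))))).congr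
    (f := fun z => (1 / 2 : ℂ) * ((fderiv ℝ φ z (Pi.single j 1) : ℂ)
      + Complex.I * (fderiv ℝ φ z (Pi.single j Complex.I) : ℂ))) fun z hz => ?_
  simp only [wirtZbarR, wirtZbar, (hasLineDerivAt_ofReal_comp hU hφ hz _).lineDeriv]

theorem continuous_Zbar {n : ℕ} {U : Set (Fin n → ℂ)} (hU : IsOpen U)
    {φ : (Fin n → ℂ) → ℝ} (hφ : ContDiffOn ℝ (⊤ : ℕ∞) φ U) (j : Fin n)
    {u : (Fin n → ℂ) × ℝ → ℂ} (hu : ContDiff ℝ (⊤ : ℕ∞) u)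
    (hus : tsupport u ⊆ U ×ˢ (Set.univ : Set ℝ)) : Continuous (Zbar φ j u) := by
  refine continuous_iff_continuousAt.2 fun p => ?_
  by_cases hp : p ∈ tsupport u
  · have hc : ContinuousAt (fun p : (Fin n → ℂ) × ℝ => wirtZbarR φ j p.1) p :=
      ContinuousAt.comp (f := Prod.fst)
        ((continuousOn_wirtZbarR hU hφ j).continuousAt (hU.mem_nhds (hus hp).1))
        continuousAt_fst
    have hD (w) : ContinuousAt (fun p => fderiv ℝ u p w) p :=
      (contDiff_fderiv_const hu w).continuous.continuousAt
    rw [Zbar_eq_fderiv φ j hu]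
    exact (continuousAt_const.mul ((hD _).add (continuousAt_const.mul (hD _)))).sub
      ((continuousAt_const.mul hc).mul (hD _))
  · have : Zbar φ j u =ᶠ[nhds p] fun _ => 0 := by
      filter_upwards [(isClosed_tsupport u).isOpen_compl.mem_nhds hp] with q hq
      exact Zbar_eq_zero_of_notMem_tsupport φ j hu hq
    exact continuousAt_const.congr this.symm

theorem pft_Zbar {n : ℕ} (φ : (Fin n → ℂ) → ℝ) (j : Fin n) {u : (Fin n → ℂ) × ℝ → ℂ}
    (hu : ContDiff ℝ (⊤ : ℕ∞) u) (huc : HasCompactSupport u) (z : Fin n → ℂ) (t : ℝ) :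
    pft (Zbar φ j u) z t = (1 / 2 : ℂ) * (pft (fun p => fderiv ℝ u p (Pi.single j 1, 0)) z t
        + Complex.I * pft (fun p => fderiv ℝ u p (Pi.single j Complex.I, 0)) z t)
      + t * wirtZbarR φ j z * pft u z t := by
  have hD (w) : Integrable fun x : ℝ =>
      Complex.exp (-(Complex.I * t * x)) * fderiv ℝ u (z, x) w :=
    integrable_exp_mul (contDiff_fderiv_const hu w).continuous (huc.fderiv_apply ℝ w) z t
  have lin {A B C : ℝ → ℂ} (hA : Integrable A) (hB : Integrable B) (hC : Integrable C) (c : ℂ) :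
      ∫ x, ((1 / 2 : ℂ) * (A x + Complex.I * B x) - c * C x)
        = (1 / 2 : ℂ) * ((∫ x, A x) + Complex.I * ∫ x, B x) - c * ∫ x, C x := by
    have hI : Integrable fun x => A x + Complex.I * B x := hA.add (hB.const_mul _)
    rw [integral_sub (hI.const_mul _) (hC.const_mul _), integral_const_mul,
      integral_add hA (hB.const_mul _), integral_const_mul, integral_const_mul]
  have h3 := pft_fderiv_snd hu huc z t
  have key : pft (Zbar φ j u) z t = (1 / 2 : ℂ) *
        (pft (fun p => fderiv ℝ u p (Pi.single j 1, 0)) z t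
        + Complex.I * pft (fun p => fderiv ℝ u p (Pi.single j Complex.I, 0)) z t)
      - Complex.I * wirtZbarR φ j z * pft (fun p => fderiv ℝ u p (0, 1)) z t := by
    simp only [pft, Zbar_eq_fderiv φ j hu]
    rw [← lin (hD _) (hD _) (hD _)]
    exact integral_congr_ae (Filter.Eventually.of_forall fun x => by ring)
  rw [key, h3]
  linear_combination (-(t * wirtZbarR φ j z * pft u z t)) * Complex.I_mul_I

theorem wirtZbar_exp_mul_pft {n : ℕ} {U : Set (Fin n → ℂ)} (hU : IsOpen U)
    {φ : (Fin n → ℂ) → ℝ} (hφ : ContDiffOn ℝ (⊤ : ℕ∞) φ U) (j : Fin n)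
    {u : (Fin n → ℂ) × ℝ → ℂ} (hu : ContDiff ℝ (⊤ : ℕ∞) u) (huc : HasCompactSupport u)
    {z : Fin n → ℂ} (hz : z ∈ U) (t : ℝ) :
    wirtZbar (fun w => Complex.exp ((t * φ w : ℝ) : ℂ) * pft u w t) j z
      = Complex.exp ((t * φ z : ℝ) : ℂ) * pft (Zbar φ j u) z t := by
  have h (v) : lineDeriv ℝ (fun w => Complex.exp ((t * φ w : ℝ) : ℂ) * pft u w t) z v
      = Complex.exp ((t * φ z : ℝ) : ℂ) * (t * (fderiv ℝ φ z v : ℂ) * pft u z t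
        + pft (fun p => fderiv ℝ u p (v, 0)) z t) := by
    have h1 : HasDerivAt _ _ (0 : ℝ) := hasLineDerivAt_ofReal_comp hU hφ hz v
    have h2 : HasDerivAt _ _ (0 : ℝ) := hasLineDerivAt_pft hu huc z v t
    have h3 := ((h1.const_mul (t : ℂ)).cexp.mul h2).deriv
    simp only [zero_smul, add_zero] at h3
    simp only [lineDeriv, Complex.ofReal_mul]
    refine h3.trans ?_
    ring
  rw [pft_Zbar φ j hu huc]
  simp only [wirtZbarR, wirtZbar, h, (hasLineDerivAt_ofReal_comp hU hφ hz _).lineDeriv]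
  ring

theorem stmt_6 {n : ℕ} (U : Set (Fin n → ℂ)) (hU : IsOpen U)
    (φ : (Fin n → ℂ) → ℝ) (hφ : ContDiffOn ℝ (⊤ : ℕ∞) φ U)
    (u v : (Fin n → ℂ) × ℝ → ℂ)
    (hu : ContDiff ℝ (⊤ : ℕ∞) u) (hucs : HasCompactSupport u)
    (husupp : tsupport u ⊆ U ×ˢ (Set.univ : Set ℝ))
    (hv : ContDiff ℝ (⊤ : ℕ∞) v) (hvcs : HasCompactSupport v)
    (hvsupp : tsupport v ⊆ U ×ˢ (Set.univ : Set ℝ)) :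
    ∑ j : Fin n, ∫ p in U ×ˢ (Set.univ : Set ℝ),
        Zbar φ j u p * (starRingEnd ℂ) (Zbar φ j v p)
      = (1 / (2 * (Real.pi : ℂ))) *
          ∫ t : ℝ, ∑ j : Fin n, ∫ z in U,
            wirtZbar (fun w => Complex.exp ((t * φ w : ℝ) : ℂ) * pft u w t) j z *
              (starRingEnd ℂ)
                (wirtZbar (fun w => Complex.exp ((t * φ w : ℝ) : ℂ) * pft v w t) j z) *
              Complex.exp ((-(2 * t * φ z) : ℝ) : ℂ) := by
  have hcu (j) := continuous_Zbar hU hφ j hu husupp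
  have hcv (j) := continuous_Zbar hU hφ j hv hvsupp
  have hsu (j) := hasCompactSupport_Zbar φ j hu hucs
  have hsv (j) := hasCompactSupport_Zbar φ j hv hvcs
  have hFG (j : Fin n) := integrable_pft_mul_conj (volume.restrict U) (hcu j) (hsu j)
    (contDiff_Zbar_snd φ j hu) (hcv j) (hsv j) (contDiff_Zbar_snd φ j hv)
  have hfib (j : Fin n) (t : ℝ) :
      ∫ z in U,
        wirtZbar (fun w => Complex.exp ((t * φ w : ℝ) : ℂ) * pft u w t) j z *
          (starRingEnd ℂ)
            (wirtZbar (fun w => Complex.exp ((t * φ w : ℝ) : ℂ) * pft v w t) j z) *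
          Complex.exp ((-(2 * t * φ z) : ℝ) : ℂ)
      = ∫ z in U, pft (Zbar φ j u) z t * conj (pft (Zbar φ j v) z t) := by
    refine setIntegral_congr_fun hU.measurableSet fun z hz => ?_
    have hexp : Complex.exp ((t * φ z : ℝ) : ℂ) * Complex.exp ((t * φ z : ℝ) : ℂ) *
        Complex.exp ((-(2 * t * φ z) : ℝ) : ℂ) = 1 := by
      rw [← Complex.exp_add, ← Complex.exp_add, ← Complex.exp_zero]
      congr 1
      push_cast
      ring
    simp only [wirtZbar_exp_mul_pft hU hφ j hu hucs hz, wirtZbar_exp_mul_pft hU hφ j hv hvcs hz,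
      map_mul, ← Complex.exp_conj, Complex.conj_ofReal]
    linear_combination (pft (Zbar φ j u) z t * conj (pft (Zbar φ j v) z t)) * hexp
  simp only [hfib]
  rw [integral_finsetSum _ fun j _ => (hFG j).integral_prod_right, Finset.mul_sum]
  refine Finset.sum_congr rfl fun j _ => ?_
  rw [← integral_mul_conj_eq_pft (volume.restrict U) (hcu j) (hsu j)
    (contDiff_Zbar_snd φ j hu) (hcv j) (hsv j) (contDiff_Zbar_snd φ j hv),
    Measure.volume_eq_prod, ← Measure.prod_restrict, Measure.restrict_univ]
end

section
/- Let φ ∈ C^∞(ℂⁿ, ℝ) and ε > 0 be such that Σ_{j,k} (∂²φ/∂z_j∂z̄_k)(z) ξ_j conj(ξ_k) ≥ ε|ξ|² for all z, ξ ∈ ℂⁿ. Fix q with 1 ≤ q ≤ n. Then for every smooth compactly supported (0,q)-form u on ℂⁿ × ℝ one has ( −i ∂u/∂x | u ) ≤ (1/(2qε)) ( ‖∂̄_b u‖² + ‖∂̄_b^† u‖² ), where the inner products and norms are the Euclidean L² ones on ℂⁿ × ℝ. -/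
/-!
STATEMENT 7: CR Nakano-type inequality on the Heisenberg-type CR manifold
`ℍ = ℂⁿ × ℝ`: if the complex Hessian of `φ` is bounded below by `ε > 0`, then
for every smooth compactly supported `(0,q)`-form `u` (`1 ≤ q ≤ n`) one has
`(−i ∂u/∂x | u) ≤ (1/(2qε)) (‖∂̄_b u‖² + ‖∂̄_b^† u‖²)`.
-/

open MeasureTheory

noncomputable section

/-- The Levi form `∂²φ/∂z_j ∂z̄_k` of the weight `φ`. -/
def leviForm {n : ℕ} (φ : (Fin n → ℂ) → ℝ) (j k : Fin n) (z : Fin n → ℂ) : ℂ :=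
  wirtZ (fun w => wirtZbarR φ k w) j z

/-- `∂̄_b` on `(0,m)`-forms, given by components
`(∂̄_b u)_{j₀…j_m} = Σ_k (−1)^k Z̄_{j_k} u_{j₀…ĵ_k…j_m}`. -/
def dbarb {n m : ℕ} (φ : (Fin n → ℂ) → ℝ)
    (w : (Fin m → Fin n) → ((Fin n → ℂ) × ℝ → ℂ)) :
    (Fin (m + 1) → Fin n) → ((Fin n → ℂ) × ℝ → ℂ) :=
  fun K p => ∑ k : Fin (m + 1),
    (-1 : ℂ) ^ (k : ℕ) * Zbar φ (K k) (w (fun i => K (k.succAbove i))) p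

/-- `∂̄_b^†` on `(0,m+1)`-forms, given by components
`(∂̄_b^† u)_I = −Σ_j Z_j u_{jI}`. -/
def dbarbAdj {n m : ℕ} (φ : (Fin n → ℂ) → ℝ)
    (w : (Fin (m + 1) → Fin n) → ((Fin n → ℂ) × ℝ → ℂ)) :
    (Fin m → Fin n) → ((Fin n → ℂ) × ℝ → ℂ) :=
  fun I p => -∑ j : Fin n, Zorig φ j (w (Fin.cons j I)) p

open Classical in
/-- The squared `L²` norm of a `(0,m)`-form:
`‖w‖² = Σ_{J strictly increasing} ∫ |w_J|²`. -/
def formNormSq {n m : ℕ} (w : (Fin m → Fin n) → ((Fin n → ℂ) × ℝ → ℂ)) : ℝ :=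
  ∑ J : Fin m → Fin n,
    if StrictMono J then ∫ p : (Fin n → ℂ) × ℝ, ‖w J p‖ ^ 2 else 0

end


/-- A family indexed by `m`-tuples is skew if permuting the tuple multiplies it by the sign. -/
def IsSkew {ι : Type*} {m : ℕ} (c : (Fin m → ι) → ℂ) : Prop :=
  ∀ (σ : Equiv.Perm (Fin m)) (J : Fin m → ι), c (J ∘ σ) = ((Equiv.Perm.sign σ : ℤ) : ℂ) * c J

theorem sign_mul_self_cast {m : ℕ} (σ : Equiv.Perm (Fin m)) :
    ((Equiv.Perm.sign σ : ℤ) : ℂ) * ((Equiv.Perm.sign σ : ℤ) : ℂ) = 1 := by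
  rw [← Int.cast_mul, ← Units.val_mul, Int.units_mul_self]; simp

theorem IsSkew.eq_zero_of_not_injective {ι : Type*} {m : ℕ} {c : (Fin m → ι) → ℂ}
    (hc : IsSkew c) {J : Fin m → ι} (hJ : ¬ Function.Injective J) : c J = 0 := by
  simp only [Function.Injective, not_forall] at hJ
  obtain ⟨a, b, hab, hne⟩ := hJ
  have h := hc (Equiv.swap a b) J
  have hJs : J ∘ Equiv.swap a b = J := by
    funext i
    rcases Equiv.swap_apply_eq_iff.mp (rfl : Equiv.swap a b i = _) with _
    by_cases hia : i = a
    · subst hia; simp [hab]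
    · by_cases hib : i = b
      · subst hib; simp [hab]
      · simp [Equiv.swap_apply_of_ne_of_ne hia hib]
  rw [hJs, Equiv.Perm.sign_swap hne] at h
  have h2 : c J = -c J := by simpa using h
  exact self_eq_neg.mp h2

theorem existsUnique_strictMono_comp {n m : ℕ} {J : Fin m → Fin n} (hJ : Function.Injective J) :
    ∃! σ : Equiv.Perm (Fin m), StrictMono (J ∘ σ) := by
  refine ⟨Tuple.sort J, (Tuple.monotone_sort J).strictMono_of_injective
    (hJ.comp (Equiv.injective _)), fun τ hτ => ?_⟩
  have h := Tuple.unique_monotone (hτ.monotone) (Tuple.monotone_sort J)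
  ext i
  exact congrArg Fin.val (hJ (congrFun h i))

open Classical in
/-- A permutation-invariant sum over all tuples is `m!` times the sum over increasing tuples. -/
theorem sum_eq_factorial_mul_sum_strictMono {n m : ℕ} {g : (Fin m → Fin n) → ℂ}
    (hg : ∀ (σ : Equiv.Perm (Fin m)) J, g (J ∘ σ) = g J)
    (hg0 : ∀ J, ¬ Function.Injective J → g J = 0) :
    ∑ J, g J = (m.factorial : ℂ) * ∑ J, if StrictMono J then g J else 0 := by
  have h1 : ∀ J, g J = ∑ σ : Equiv.Perm (Fin m), if StrictMono (J ∘ σ) then g (J ∘ σ) else 0 := by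
    intro J
    by_cases hJ : Function.Injective J
    · obtain ⟨σ, hσ, huniq⟩ := existsUnique_strictMono_comp hJ
      rw [Finset.sum_eq_single σ]
      · rw [if_pos hσ, hg]
      · intro τ _ hτ
        exact if_neg fun h => hτ (huniq τ h)
      · simp
    · simp [hg, hg0 J hJ]
  rw [Finset.sum_congr rfl fun J _ => h1 J, Finset.sum_comm]
  have h2 : ∀ σ : Equiv.Perm (Fin m),
      (∑ J : Fin m → Fin n, if StrictMono (J ∘ σ) then g (J ∘ σ) else 0)
        = ∑ J : Fin m → Fin n, if StrictMono J then g J else 0 := fun σ =>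
    (σ.symm.arrowCongr (Equiv.refl (Fin n))).sum_comp
      (fun J => if StrictMono J then g J else 0)
  simp [h2, Fintype.card_perm]

theorem comp_cycleRange_symm {ι : Type*} {m : ℕ} (J : Fin (m + 1) → ι) (k : Fin (m + 1)) :
    J ∘ k.cycleRange.symm = Fin.cons (J k) (fun i => J (k.succAbove i)) := by
  funext i
  refine Fin.cases ?_ (fun i => ?_) i <;> simp [Fin.cycleRange_symm_succ]

theorem sign_cycleRange_symm_cast {m : ℕ} (k : Fin (m + 1)) :
    ((Equiv.Perm.sign k.cycleRange.symm : ℤ) : ℂ) = (-1) ^ (k : ℕ) := by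
  simp [Equiv.Perm.sign_symm, Fin.sign_cycleRange]

theorem IsSkew.cons_succAbove {ι : Type*} {m : ℕ} {c : (Fin (m + 1) → ι) → ℂ} (hc : IsSkew c)
    (J : Fin (m + 1) → ι) (k : Fin (m + 1)) :
    c (Fin.cons (J k) (fun i => J (k.succAbove i))) = (-1) ^ (k : ℕ) * c J := by
  rw [← comp_cycleRange_symm, hc, sign_cycleRange_symm_cast]

/-- The alternating sum `Σ_k (-1)^k b_{K_k, K ∖ K_k}` defining the exterior derivative. -/
def wedgeSum {ι : Type*} {m : ℕ} (b : ι → (Fin m → ι) → ℂ) (K : Fin (m + 1) → ι) : ℂ :=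
  ∑ k : Fin (m + 1), (-1) ^ (k : ℕ) * b (K k) (fun i => K (k.succAbove i))

theorem exists_perm_succAbove {m : ℕ} (σ : Equiv.Perm (Fin (m + 1))) (k : Fin (m + 1)) :
    ∃ τ : Equiv.Perm (Fin m), (∀ i, σ (k.succAbove i) = (σ k).succAbove (τ i)) ∧
      (-1) ^ (k : ℕ) * ((Equiv.Perm.sign τ : ℤ) : ℂ)
        = ((Equiv.Perm.sign σ : ℤ) : ℂ) * (-1) ^ ((σ k : Fin (m + 1)) : ℕ) := by
  set π : Equiv.Perm (Fin (m + 1)) := (σ k).cycleRange * σ * k.cycleRange.symm with hπ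
  have hπ0 : π 0 = 0 := by simp [hπ]
  obtain ⟨⟨p, τ⟩, hpτ⟩ := Equiv.Perm.decomposeFin.symm.surjective π
  have hp : p = 0 := by
    have := Equiv.Perm.decomposeFin_symm_apply_zero p τ
    rw [hpτ, hπ0] at this
    exact this.symm
  subst hp
  refine ⟨τ, fun i => ?_, ?_⟩
  · have h1 : π i.succ = (τ i).succ := by
      rw [← hpτ, Equiv.Perm.decomposeFin_symm_apply_succ]; simp
    rw [← Fin.cycleRange_symm_succ, ← Fin.cycleRange_symm_succ, ← h1]
    simp [hπ]
  · have h2 : Equiv.Perm.sign π = Equiv.Perm.sign τ := by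
      rw [← hpτ, Equiv.Perm.decomposeFin.symm_sign]; simp
    rw [← h2, hπ]
    simp only [Equiv.Perm.sign_mul, Fin.sign_cycleRange, Equiv.Perm.sign_symm]
    push_cast
    have : ((-1 : ℂ) ^ (k : ℕ)) * (-1) ^ (k : ℕ) = 1 := by
      rw [← mul_pow]; simp
    linear_combination ((-1 : ℂ) ^ ((σ k : Fin (m + 1)) : ℕ) * ((Equiv.Perm.sign σ : ℤ) : ℂ)) * this

theorem isSkew_wedgeSum {ι : Type*} {m : ℕ} {b : ι → (Fin m → ι) → ℂ} (hb : ∀ j, IsSkew (b j)) :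
    IsSkew (wedgeSum b) := by
  intro σ K
  unfold wedgeSum
  rw [Finset.mul_sum, ← Equiv.sum_comp σ fun k : Fin (m + 1) => ((Equiv.Perm.sign σ : ℤ) : ℂ) *
    ((-1) ^ (k : ℕ) * b (K k) fun i => K (k.succAbove i))]
  refine Finset.sum_congr rfl fun k _ => ?_
  obtain ⟨τ, hτ, hs⟩ := exists_perm_succAbove σ k
  have h1 : (fun i => (K ∘ σ) (k.succAbove i)) = (fun i => K ((σ k).succAbove i)) ∘ τ := by
    funext i; simp [hτ]
  rw [h1, hb, Function.comp_apply, ← mul_assoc, ← mul_assoc, hs]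

theorem sum_cons {ι : Type*} [Fintype ι] {m : ℕ} (f : (Fin (m + 1) → ι) → ℂ) :
    ∑ K, f K = ∑ j, ∑ J : Fin m → ι, f (Fin.cons j J) := by
  rw [← (Fin.consEquiv fun _ => ι).sum_comp, Fintype.sum_prod_type]; rfl

open ComplexConjugate

theorem IsSkew.conj_mul {ι : Type*} {m : ℕ} {c d : (Fin m → ι) → ℂ} (hc : IsSkew c)
    (hd : IsSkew d) (σ : Equiv.Perm (Fin m)) (J : Fin m → ι) :
    c (J ∘ σ) * conj (d (J ∘ σ)) = c J * conj (d J) := by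
  rw [hc, hd, map_mul, map_intCast]
  linear_combination (c J * conj (d J)) * sign_mul_self_cast σ

theorem sum_wedgeSum_mul_conj {ι : Type*} [Fintype ι] {m : ℕ} (b : ι → (Fin m → ι) → ℂ)
    {d : (Fin (m + 1) → ι) → ℂ} (hd : IsSkew d) :
    ∑ K, wedgeSum b K * conj (d K) = (m + 1) * ∑ j, ∑ J, b j J * conj (d (Fin.cons j J)) := by
  have h1 : ∀ k : Fin (m + 1), ∑ K : Fin (m + 1) → ι,
      (-1) ^ (k : ℕ) * b (K k) (fun i => K (k.succAbove i)) * conj (d K)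
        = ∑ j, ∑ J, b j J * conj (d (Fin.cons j J)) := by
    intro k
    have h0 := sum_cons (fun K => b (K 0) (Fin.tail K) * conj (d K))
    simp only [Fin.cons_zero, Fin.tail_cons] at h0
    rw [← h0]
    symm
    rw [← (k.cycleRange.arrowCongr (Equiv.refl ι)).sum_comp]
    refine Finset.sum_congr rfl fun K _ => ?_
    have h2 : (k.cycleRange.arrowCongr (Equiv.refl ι)) K
      = Fin.cons (K k) (fun i => K (k.succAbove i)) := comp_cycleRange_symm K k
    rw [h2, hd.cons_succAbove]
    simp only [Fin.cons_zero, Fin.tail_cons, map_mul, map_pow, map_neg, map_one]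
    ring
  simp only [wedgeSum, Finset.sum_mul]
  rw [Finset.sum_comm, Finset.sum_congr rfl fun k _ => h1 k]
  simp

theorem sum_wedgeSum_sq {ι : Type*} [Fintype ι] {m : ℕ} {b : ι → (Fin (m + 1) → ι) → ℂ}
    (hb : ∀ j, IsSkew (b j)) :
    ∑ K, wedgeSum b K * conj (wedgeSum b K)
      = (m + 2) * (∑ j, ∑ J, b j J * conj (b j J)
        - (m + 1) * ∑ I : Fin m → ι, ∑ j, ∑ l, b j (Fin.cons l I) * conj (b l (Fin.cons j I))) := by
  rw [sum_wedgeSum_mul_conj b (isSkew_wedgeSum hb)]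
  have h1 : ∀ j J, wedgeSum b (Fin.cons j J)
      = b j J - ∑ k : Fin (m + 1), (-1) ^ (k : ℕ) *
        b (J k) (Fin.cons j fun i => J (k.succAbove i)) := by
    intro j J
    rw [wedgeSum, Fin.sum_univ_succ, sub_eq_add_neg, ← Finset.sum_neg_distrib]
    congr 1
    · simp
    · refine Finset.sum_congr rfl fun k _ => ?_
      have : (fun i => (Fin.cons j J : Fin (m + 2) → ι) (k.succ.succAbove i))
          = Fin.cons j fun i => J (k.succAbove i) := by
        funext i
        refine Fin.cases ?_ (fun i => ?_) i <;> simp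
      rw [this]
      simp [pow_succ]
  have h2 : ∀ j (k : Fin (m + 1)), ∑ J : Fin (m + 1) → ι, b j J *
      conj ((-1) ^ (k : ℕ) * b (J k) (Fin.cons j fun i => J (k.succAbove i)))
        = ∑ l, ∑ I : Fin m → ι, b j (Fin.cons l I) * conj (b l (Fin.cons j I)) := by
    intro j k
    have h0 := sum_cons (fun J => b j J * conj (b (J 0) (Fin.cons j (Fin.tail J))))
    simp only [Fin.cons_zero, Fin.tail_cons] at h0
    rw [← h0]
    symm
    rw [← (k.cycleRange.arrowCongr (Equiv.refl ι)).sum_comp]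
    refine Finset.sum_congr rfl fun J _ => ?_
    have h2 : (k.cycleRange.arrowCongr (Equiv.refl ι)) J
      = Fin.cons (J k) (fun i => J (k.succAbove i)) := comp_cycleRange_symm J k
    rw [h2, (hb j).cons_succAbove]
    simp only [Fin.cons_zero, Fin.tail_cons, map_mul, map_pow, map_neg, map_one]
    ring
  have h3 : ∀ j, ∑ J, b j J * conj (wedgeSum b (Fin.cons j J))
      = ∑ J, b j J * conj (b j J)
        - (m + 1) * ∑ l, ∑ I : Fin m → ι, b j (Fin.cons l I) * conj (b l (Fin.cons j I)) := by
    intro j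
    simp only [h1, map_sub, mul_sub, Finset.sum_sub_distrib, map_sum, Finset.mul_sum]
    rw [Finset.sum_comm (s := (Finset.univ : Finset (Fin (m + 1) → ι)))]
    congr 1
    rw [Finset.sum_congr rfl fun k _ => h2 j k]
    simp [Finset.mul_sum]
  rw [Finset.sum_congr rfl fun j _ => h3 j, Finset.sum_sub_distrib, ← Finset.mul_sum]
  have h4 : ∑ j, ∑ l, ∑ I : Fin m → ι, b j (Fin.cons l I) * conj (b l (Fin.cons j I))
      = ∑ I : Fin m → ι, ∑ j, ∑ l, b j (Fin.cons l I) * conj (b l (Fin.cons j I)) := by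
    rw [Finset.sum_congr rfl fun j _ => Finset.sum_comm, Finset.sum_comm]
  rw [h4]
  push_cast
  ring

section PartialFourier

open ComplexConjugate FourierTransform
open scoped ContDiff

/-- Smooth compactly supported complex-valued functions. -/
def IsTest {X : Type*} [NormedAddCommGroup X] [NormedSpace ℝ X] (a : X → ℂ) : Prop :=
  ContDiff ℝ ∞ a ∧ HasCompactSupport a

/-- The directional derivative of `a` in the constant direction `v`. -/
noncomputable def dirD {X : Type*} [NormedAddCommGroup X] [NormedSpace ℝ X] (v : X) (a : X → ℂ) :
    X → ℂ :=
  fun p => fderiv ℝ a p v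

section TestFunctions

variable {X : Type*} [NormedAddCommGroup X] [NormedSpace ℝ X] {a b : X → ℂ}

theorem contDiff_dirD (ha : ContDiff ℝ ∞ a) (v : X) : ContDiff ℝ ∞ (dirD v a) :=
  (ha.fderiv_right (m := ∞) (by simp)).clm_apply contDiff_const

theorem IsTest.dirD (ha : IsTest a) (v : X) : IsTest (dirD v a) :=
  ⟨contDiff_dirD ha.1 v, ha.2.fderiv_apply ℝ v⟩

theorem IsTest.add (ha : IsTest a) (hb : IsTest b) : IsTest fun p => a p + b p :=
  ⟨ha.1.add hb.1, ha.2.add hb.2⟩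

theorem IsTest.smooth_mul {g : X → ℂ} (hg : ContDiff ℝ ∞ g) (ha : IsTest a) :
    IsTest fun p => g p * a p :=
  ⟨hg.mul ha.1, ha.2.mul_left⟩

theorem IsTest.const_mul (c : ℂ) (ha : IsTest a) : IsTest fun p => c * a p :=
  ha.smooth_mul contDiff_const

theorem IsTest.zero : IsTest (fun _ : X => (0 : ℂ)) :=
  ⟨contDiff_const, HasCompactSupport.zero⟩

theorem IsTest.sum {ι : Type*} (s : Finset ι) {f : ι → X → ℂ} (hf : ∀ i, IsTest (f i)) :
    IsTest fun p => ∑ i ∈ s, f i p := by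
  classical
  induction s using Finset.induction_on with
  | empty => simpa using IsTest.zero
  | insert i s hi ih => simpa [Finset.sum_insert hi] using (hf i).add ih

theorem IsTest.mul_conj (ha : IsTest a) (hb : IsTest b) : IsTest fun p => a p * conj (b p) := by
  refine ⟨ha.1.mul ?_, ha.2.mul_right⟩
  exact Complex.conjCLE.contDiff.comp hb.1

theorem IsTest.integrable [MeasurableSpace X] [OpensMeasurableSpace X]
    {μ : Measure X} [IsFiniteMeasureOnCompacts μ] (ha : IsTest a) : Integrable a μ :=
  ha.1.continuous.integrable_of_hasCompactSupport ha.2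

end TestFunctions

section General

variable {V : Type*}

/-- The partial Fourier transform of `a` in the real variable, at frequency `ξ`. -/
noncomputable def ftx (ξ : ℝ) (a : V × ℝ → ℂ) (z : V) : ℂ := 𝓕 (fun x : ℝ => a (z, x)) ξ

theorem ftx_eq_integral (ξ : ℝ) (a : V × ℝ → ℂ) (z : V) :
    ftx ξ a z = ∫ x : ℝ, Complex.exp (↑(-2 * Real.pi * x * ξ) * Complex.I) * a (z, x) := by
  rw [ftx, Real.fourier_real_eq_integral_exp_smul]; rfl

theorem ftx_fst_mul (g : V → ℂ) (a : V × ℝ → ℂ) (ξ : ℝ) (z : V) :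
    ftx ξ (fun p => g p.1 * a p) z = g z * ftx ξ a z := by
  simp only [ftx_eq_integral]
  rw [← integral_const_mul]
  congr 1 with x
  ring

theorem ftx_const_mul (c : ℂ) (a : V × ℝ → ℂ) (ξ : ℝ) (z : V) :
    ftx ξ (fun p => c * a p) z = c * ftx ξ a z :=
  ftx_fst_mul (fun _ => c) a ξ z

theorem eq_zero_of_snd_notMem [TopologicalSpace V] (a : V × ℝ → ℂ) {z : V} {x : ℝ}
    (hx : x ∉ Prod.snd '' tsupport a) : a (z, x) = 0 := by
  by_contra h
  exact hx ⟨(z, x), subset_tsupport a h, rfl⟩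

section Pairing

variable [MeasureSpace V]

/-- The `L²` pairing of the partial Fourier transforms at frequency `ξ`. -/
noncomputable def freqInner (ξ : ℝ) (a b : V × ℝ → ℂ) : ℂ :=
  ∫ z : V, ftx ξ a z * conj (ftx ξ b z)

theorem freqInner_conj (a b : V × ℝ → ℂ) (ξ : ℝ) :
    conj (freqInner ξ a b) = freqInner ξ b a := by
  rw [freqInner, ← integral_conj, freqInner]
  congr 1 with z
  simp [mul_comm]

theorem freqInner_self_re_nonneg (a : V × ℝ → ℂ) (ξ : ℝ) : 0 ≤ (freqInner ξ a a).re := by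
  have h : freqInner ξ a a = ((∫ z : V, ‖ftx ξ a z‖ ^ 2 : ℝ) : ℂ) := by
    rw [← integral_complex_ofReal, freqInner]
    congr 1 with z
    rw [Complex.mul_conj, Complex.normSq_eq_norm_sq]
  rw [h, Complex.ofReal_re]
  positivity

theorem freqInner_fst_mul_left (g : V → ℂ) (a b : V × ℝ → ℂ) (ξ : ℝ) :
    freqInner ξ (fun p => g p.1 * a p) b = freqInner ξ a (fun p => conj (g p.1) * b p) := by
  simp only [freqInner, ftx_fst_mul g, ftx_fst_mul fun z => conj (g z)]
  congr 1 with z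
  simp
  ring

theorem freqInner_const_mul_left (c : ℂ) (a b : V × ℝ → ℂ) (ξ : ℝ) :
    freqInner ξ (fun p => c * a p) b = c * freqInner ξ a b := by
  simp only [freqInner, ftx_const_mul, mul_assoc, integral_const_mul]

end Pairing

end General

variable {V : Type*} [NormedAddCommGroup V] [NormedSpace ℝ V] {a b : V × ℝ → ℂ}

theorem IsTest.slice (ha : IsTest a) (z : V) : IsTest fun x : ℝ => a (z, x) :=
  ⟨ha.1.comp (contDiff_const.prodMk contDiff_id),
    ha.2.comp_isClosedEmbedding (Topology.IsClosedEmbedding.of_continuous_injective_isClosedMap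
      (by fun_prop) (fun x y h => (Prod.ext_iff.mp h).2) (isClosedMap_prodMk_left z))⟩

theorem IsTest.integrable_exp_mul (ha : IsTest a) (ξ : ℝ) (z : V) :
    Integrable fun x : ℝ => Complex.exp (↑(-2 * Real.pi * x * ξ) * Complex.I) * a (z, x) :=
  (Continuous.mul (by fun_prop) (ha.slice z).1.continuous).integrable_of_hasCompactSupport
    (ha.slice z).2.mul_left

theorem ftx_add (ha : IsTest a) (hb : IsTest b) (ξ : ℝ) (z : V) :
    ftx ξ (fun p => a p + b p) z = ftx ξ a z + ftx ξ b z := by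
  simp only [ftx_eq_integral, mul_add]
  exact integral_add (ha.integrable_exp_mul ξ z) (hb.integrable_exp_mul ξ z)

theorem ftx_sum {ι : Type*} (s : Finset ι) {f : ι → V × ℝ → ℂ} (hf : ∀ i, IsTest (f i))
    (ξ : ℝ) (z : V) :
    ftx ξ (fun p => ∑ i ∈ s, f i p) z = ∑ i ∈ s, ftx ξ (f i) z := by
  simp only [ftx_eq_integral, Finset.mul_sum]
  exact integral_finsetSum _ fun i _ => (hf i).integrable_exp_mul ξ z

theorem dirD_snd (ha : ContDiff ℝ ∞ a) (z : V) (x : ℝ) :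
    dirD ((0, 1) : V × ℝ) a (z, x) = deriv (fun s => a (z, s)) x := by
  have h1 : HasFDerivAt a (fderiv ℝ a (z, x)) (z, x) :=
    (ha.differentiable (by simp) _).hasFDerivAt
  have h2 : HasDerivAt (fun s : ℝ => ((z, s) : V × ℝ)) (0, 1) x :=
    (hasDerivAt_const x z).prodMk (hasDerivAt_id x)
  exact (h1.comp_hasDerivAt x h2).deriv.symm

theorem ftx_dirD_snd (ha : IsTest a) (ξ : ℝ) (z : V) :
    ftx ξ (dirD ((0, 1) : V × ℝ) a) z = 2 * Real.pi * Complex.I * ξ * ftx ξ a z := by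
  have h1 : (fun x : ℝ => dirD ((0, 1) : V × ℝ) a (z, x)) = deriv fun x => a (z, x) :=
    funext fun x => dirD_snd ha.1 z x
  have h2 : Integrable (deriv fun x : ℝ => a (z, x)) := h1 ▸ ((ha.dirD _).slice z).integrable
  have h3 := Real.fourier_deriv (ha.slice z).integrable ((ha.slice z).1.differentiable (by simp)) h2
  rw [ftx, h1, h3]
  simp [ftx]

theorem hasCompactSupport_ftx (ha : IsTest a) (ξ : ℝ) : HasCompactSupport (ftx ξ a) := by
  refine HasCompactSupport.intro (ha.2.isCompact.image continuous_fst) fun z hz => ?_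
  have : ∀ x : ℝ, a (z, x) = 0 := fun x => by
    by_contra h
    exact hz ⟨(z, x), subset_tsupport a h, rfl⟩
  simp [ftx_eq_integral, this]

theorem continuous_ftx [FiniteDimensional ℝ V] (ha : IsTest a) :
    Continuous fun p : V × ℝ => ftx p.2 a p.1 := by
  have : ProperSpace V := FiniteDimensional.proper_real V
  have hS : IsCompact (Prod.snd '' tsupport a) := ha.2.isCompact.image continuous_snd
  have hcont := ha.1.continuous
  have h := continuous_parametric_integral_of_continuous (μ := (volume : Measure ℝ))
    (f := fun (p : V × ℝ) (x : ℝ) =>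
      Complex.exp (↑(-2 * Real.pi * x * p.2) * Complex.I) * a (p.1, x))
    (by unfold Function.uncurry; fun_prop) hS
  convert h using 1
  funext p
  rw [ftx_eq_integral, setIntegral_eq_integral_of_forall_compl_eq_zero]
  intro x hx
  rw [eq_zero_of_snd_notMem a hx, mul_zero]

theorem continuous_ftx_fst [FiniteDimensional ℝ V] (ha : IsTest a) (ξ : ℝ) :
    Continuous (ftx ξ a) :=
  (continuous_ftx ha).comp (continuous_id.prodMk continuous_const)

theorem hasLineDerivAt_ftx (ha : IsTest a) (ξ : ℝ) (z v : V) :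
    HasLineDerivAt ℝ (ftx ξ a) (ftx ξ (dirD ((v, 0) : V × ℝ) a) z) z v := by
  have hd := ha.dirD ((v, 0) : V × ℝ)
  obtain ⟨C, hC⟩ := hd.1.continuous.bounded_above_of_compact_support hd.2
  have hS : IsCompact (Prod.snd '' tsupport a) := ha.2.isCompact.image continuous_snd
  have h := hasDerivAt_integral_of_dominated_loc_of_deriv_le (μ := (volume : Measure ℝ))
    (F := fun (t : ℝ) (x : ℝ) =>
      Complex.exp (↑(-2 * Real.pi * x * ξ) * Complex.I) * a (z + t • v, x))
    (F' := fun (t : ℝ) (x : ℝ) => Complex.exp (↑(-2 * Real.pi * x * ξ) * Complex.I) *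
      dirD ((v, 0) : V × ℝ) a (z + t • v, x))
    (bound := (Prod.snd '' tsupport a).indicator fun _ => C) (x₀ := 0) Filter.univ_mem
    (Filter.Eventually.of_forall fun t => (ha.integrable_exp_mul ξ _).aestronglyMeasurable)
    (ha.integrable_exp_mul ξ _) (hd.integrable_exp_mul ξ _).aestronglyMeasurable
    (Filter.Eventually.of_forall fun x t _ => ?_) ?_
    (Filter.Eventually.of_forall fun x t _ => ?_)
  · have h2 := h.2
    simp only [← ftx_eq_integral, zero_smul, add_zero] at h2
    exact h2
  · rw [norm_mul, Complex.norm_exp_ofReal_mul_I, one_mul]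
    by_cases hx : x ∈ Prod.snd '' tsupport a
    · rw [Set.indicator_of_mem hx]
      exact hC _
    · have h0 : fderiv ℝ a (z + t • v, x) = 0 := by
        by_contra hne
        exact hx ⟨(z + t • v, x), support_fderiv_subset ℝ hne, rfl⟩
      simp [dirD, h0, hx]
  · exact (integrable_indicator_iff hS.measurableSet).mpr
      (integrableOn_const hS.measure_lt_top.ne)
  · have h1 : HasFDerivAt a (fderiv ℝ a (z + t • v, x)) (z + t • v, x) :=
      (ha.1.differentiable (by simp) _).hasFDerivAt
    have h2 : HasDerivAt (fun s : ℝ => ((z + s • v, x) : V × ℝ)) (v, 0) t := by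
      have := (((hasDerivAt_id t).smul_const v).const_add z).prodMk (hasDerivAt_const t x)
      simpa using this
    exact (h1.comp_hasDerivAt t h2).const_mul _

theorem plancherel_slice (ha : IsTest a) (hb : IsTest b) (z : V) :
    ∫ ξ : ℝ, ftx ξ a z * conj (ftx ξ b z) = ∫ x : ℝ, a (z, x) * conj (b (z, x)) := by
  have h := SchwartzMap.integral_inner_fourier_fourier
    ((hb.slice z).2.toSchwartzMap (hb.slice z).1) ((ha.slice z).2.toSchwartzMap (ha.slice z).1)
  have hA : ⇑((ha.slice z).2.toSchwartzMap (ha.slice z).1) = fun x => a (z, x) := rfl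
  have hB : ⇑((hb.slice z).2.toSchwartzMap (hb.slice z).1) = fun x => b (z, x) := rfl
  simpa [SchwartzMap.fourier_coe, ftx, hA, hB] using h

theorem integrable_ftx_slice (ha : IsTest a) (z : V) :
    Integrable fun ξ : ℝ => ‖ftx ξ a z‖ ^ 2 := by
  have h := (𝓕 ((ha.slice z).2.toSchwartzMap (ha.slice z).1)).memLp 2 (volume : Measure ℝ)
  have hA : ⇑((ha.slice z).2.toSchwartzMap (ha.slice z).1) = fun x => a (z, x) := rfl
  simpa [SchwartzMap.fourier_coe, ftx, hA] using (memLp_two_iff_integrable_sq_norm h.1).mp h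

section FreqInner

variable [MeasureSpace V]

theorem freqInner_dirD_snd_left (ha : IsTest a) (b : V × ℝ → ℂ) (ξ : ℝ) :
    freqInner ξ (dirD ((0, 1) : V × ℝ) a) b = 2 * Real.pi * Complex.I * ξ * freqInner ξ a b := by
  simp only [freqInner, ftx_dirD_snd ha, mul_assoc, integral_const_mul]

section Haar

variable [FiniteDimensional ℝ V] [BorelSpace V] [(volume : Measure V).IsAddHaarMeasure]

theorem integrable_ftx_mul_conj (ha : IsTest a) (hb : IsTest b) (ξ : ℝ) :
    Integrable fun z : V => ftx ξ a z * conj (ftx ξ b z) :=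
  ((continuous_ftx_fst ha ξ).mul
    (Complex.continuous_conj.comp (continuous_ftx_fst hb ξ))).integrable_of_hasCompactSupport
    (hasCompactSupport_ftx ha ξ).mul_right

theorem freqInner_add_left {c : V × ℝ → ℂ} (ha : IsTest a) (hb : IsTest b) (hc : IsTest c)
    (ξ : ℝ) : freqInner ξ (fun p => a p + b p) c = freqInner ξ a c + freqInner ξ b c := by
  simp only [freqInner, ftx_add ha hb, add_mul]
  exact integral_add (integrable_ftx_mul_conj ha hc ξ) (integrable_ftx_mul_conj hb hc ξ)

theorem freqInner_dirD_fst (ha : IsTest a) (hb : IsTest b) (ξ : ℝ) (v : V) :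
    freqInner ξ (dirD ((v, 0) : V × ℝ) a) b = -freqInner ξ a (dirD ((v, 0) : V × ℝ) b) := by
  have hda := ha.dirD ((v, 0) : V × ℝ)
  have hdb := hb.dirD ((v, 0) : V × ℝ)
  have h := integral_bilinear_hasLineDerivAt_right_eq_neg_left_of_integrable
    (μ := (volume : Measure V)) (f := ftx ξ a) (f' := ftx ξ (dirD ((v, 0) : V × ℝ) a))
    (g := fun z => conj (ftx ξ b z)) (g' := fun z => conj (ftx ξ (dirD ((v, 0) : V × ℝ) b) z))
    (v := v) (B := ContinuousLinearMap.mul ℝ ℂ)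
    (integrable_ftx_mul_conj hda hb ξ) (integrable_ftx_mul_conj ha hdb ξ)
    (integrable_ftx_mul_conj ha hb ξ) (fun z _ => hasLineDerivAt_ftx ha ξ z v)
    (fun z _ => Complex.conjCLE.hasFDerivAt.comp_hasDerivAt (0 : ℝ) (hasLineDerivAt_ftx hb ξ z v))
  simp only [ContinuousLinearMap.mul_apply'] at h
  rw [freqInner, freqInner, h, neg_neg]

theorem integrable_normSq_ftx_prod (ha : IsTest a) :
    Integrable fun p : V × ℝ => ‖ftx p.2 a p.1‖ ^ 2 := by
  have hm : Continuous fun p : V × ℝ => ‖ftx p.2 a p.1‖ ^ 2 := (continuous_ftx ha).norm.pow 2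
  rw [Measure.volume_eq_prod, integrable_prod_iff hm.aestronglyMeasurable]
  refine ⟨Filter.Eventually.of_forall fun z => integrable_ftx_slice ha z, ?_⟩
  have h1 := (ha.mul_conj ha).integrable (μ := (volume : Measure V).prod (volume : Measure ℝ))
  refine h1.integral_prod_left.norm.congr (Filter.Eventually.of_forall fun z => ?_)
  simp only [norm_pow, norm_norm]
  rw [← plancherel_slice ha ha]
  have h2 : ∀ ξ : ℝ, ftx ξ a z * conj (ftx ξ a z) = ((‖ftx ξ a z‖ ^ 2 : ℝ) : ℂ) := fun ξ => by
    rw [Complex.mul_conj, Complex.normSq_eq_norm_sq]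
  simp only [h2, integral_complex_ofReal, Complex.norm_real]
  exact Real.norm_of_nonneg (by positivity)

theorem integrable_ftx_mul_conj_prod (ha : IsTest a) (hb : IsTest b) :
    Integrable (fun p : V × ℝ => ftx p.2 a p.1 * conj (ftx p.2 b p.1))
      ((volume : Measure V).prod (volume : Measure ℝ)) := by
  refine ((integrable_normSq_ftx_prod ha).add (integrable_normSq_ftx_prod hb)).mono'
    ((continuous_ftx ha).mul
      (Complex.continuous_conj.comp (continuous_ftx hb))).aestronglyMeasurable
    (Filter.Eventually.of_forall fun p => ?_)
  simp only [norm_mul, RCLike.norm_conj, Pi.add_apply]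
  nlinarith [sq_nonneg (‖ftx p.2 a p.1‖ - ‖ftx p.2 b p.1‖),
    sq_nonneg (‖ftx p.2 a p.1‖ + ‖ftx p.2 b p.1‖)]

theorem integrable_freqInner (ha : IsTest a) (hb : IsTest b) :
    Integrable fun ξ : ℝ => freqInner ξ a b :=
  (integrable_ftx_mul_conj_prod ha hb).integral_prod_right

/-- Plancherel's theorem in the real variable. -/
theorem integral_freqInner (ha : IsTest a) (hb : IsTest b) :
    ∫ ξ : ℝ, freqInner ξ a b = ∫ p : V × ℝ, a p * conj (b p) := by
  rw [Measure.volume_eq_prod, integral_prod _ (ha.mul_conj hb).integrable]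
  simp only [freqInner, ← plancherel_slice ha hb]
  exact (integral_integral_swap (integrable_ftx_mul_conj_prod ha hb)).symm

end Haar

end FreqInner

end PartialFourier

section Commutator

open scoped ContDiff

variable {X : Type*} [NormedAddCommGroup X] [NormedSpace ℝ X] {a b : X → ℂ}

/-- The constant-coefficient complex vector field `c ∂_v + d ∂_w`. -/
noncomputable def vecD (c d : ℂ) (v w : X) (a : X → ℂ) : X → ℂ :=
  fun p => c * dirD v a p + d * dirD w a p

theorem contDiff_vecD (c d : ℂ) (v w : X) (ha : ContDiff ℝ ∞ a) :
    ContDiff ℝ ∞ (vecD c d v w a) :=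
  (contDiff_const.mul (contDiff_dirD ha v)).add (contDiff_const.mul (contDiff_dirD ha w))

theorem dirD_add (ha : ContDiff ℝ ∞ a) (hb : ContDiff ℝ ∞ b) (v p : X) :
    dirD v (fun p => a p + b p) p = dirD v a p + dirD v b p := by
  rw [dirD, fderiv_fun_add (ha.differentiable (by simp) p) (hb.differentiable (by simp) p)]
  rfl

theorem dirD_mul (ha : ContDiff ℝ ∞ a) (hb : ContDiff ℝ ∞ b) (v p : X) :
    dirD v (fun p => a p * b p) p = dirD v a p * b p + a p * dirD v b p := by
  rw [dirD, fderiv_fun_mul (ha.differentiable (by simp) p) (hb.differentiable (by simp) p)]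
  simp [dirD]
  ring

theorem dirD_const_mul (ha : ContDiff ℝ ∞ a) (c : ℂ) (v p : X) :
    dirD v (fun p => c * a p) p = c * dirD v a p := by
  rw [dirD_mul contDiff_const ha]
  simp [dirD]

theorem dirD_comm (ha : ContDiff ℝ ∞ a) (v w p : X) :
    dirD v (dirD w a) p = dirD w (dirD v a) p := by
  have h : ∀ v w : X, dirD v (dirD w a) p = fderiv ℝ (fderiv ℝ a) p v w := by
    intro v w
    have h1 : DifferentiableAt ℝ (fderiv ℝ a) p :=
      (ha.fderiv_right (m := ∞) (by simp)).differentiable (by simp) p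
    have h2 := (h1.hasFDerivAt.clm_apply (hasFDerivAt_const w p)).fderiv
    change fderiv ℝ (fun q => fderiv ℝ a q w) p v = _
    rw [h2]
    simp
  have hs : IsSymmSndFDerivAt ℝ a p := ha.contDiffAt.isSymmSndFDerivAt (by
    rw [minSmoothness_of_isRCLikeNormedField]; exact WithTop.coe_le_coe.mpr le_top)
  rw [h, h]
  exact hs v w

variable (c d c' d' : ℂ) (v w v' w' : X)

theorem vecD_add (ha : ContDiff ℝ ∞ a) (hb : ContDiff ℝ ∞ b) (p : X) :
    vecD c d v w (fun p => a p + b p) p = vecD c d v w a p + vecD c d v w b p := by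
  simp only [vecD, dirD_add ha hb]
  ring

theorem vecD_mul (ha : ContDiff ℝ ∞ a) (hb : ContDiff ℝ ∞ b) (p : X) :
    vecD c d v w (fun p => a p * b p) p
      = vecD c d v w a p * b p + a p * vecD c d v w b p := by
  simp only [vecD, dirD_mul ha hb]
  ring

theorem vecD_comm (ha : ContDiff ℝ ∞ a) (p : X) :
    vecD c d v w (vecD c' d' v' w' a) p = vecD c' d' v' w' (vecD c d v w a) p := by
  have h : ∀ (c d c' d' : ℂ) (v w v' w' : X), vecD c d v w (vecD c' d' v' w' a) p
      = c * (c' * dirD v (dirD v' a) p + d' * dirD v (dirD w' a) p)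
        + d * (c' * dirD w (dirD v' a) p + d' * dirD w (dirD w' a) p) := by
    intro c d c' d' v w v' w'
    have h1 : ∀ v p, dirD v (vecD c' d' v' w' a) p
        = c' * dirD v (dirD v' a) p + d' * dirD v (dirD w' a) p := by
      intro v p
      have hv := contDiff_dirD ha v'
      have hw := contDiff_dirD ha w'
      rw [← dirD_const_mul hv, ← dirD_const_mul hw,
        ← dirD_add (contDiff_const.mul hv) (contDiff_const.mul hw)]
      rfl
    change c * dirD v (vecD c' d' v' w' a) p + d * dirD w (vecD c' d' v' w' a) p = _
    rw [h1, h1]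
  rw [h, h, dirD_comm ha v v', dirD_comm ha v w', dirD_comm ha w v', dirD_comm ha w w']
  ring

theorem vecD_one_zero (a : X → ℂ) : vecD 1 0 v w a = dirD v a := by
  funext p
  simp [vecD]

/-- The commutator of `L + s (LΦ) T` and `M - s (MΦ) T` when `T Φ = 0`. -/
theorem commutator_vecD (s : ℂ) {Φ : X → ℂ} (hΦ : ContDiff ℝ ∞ Φ) (t : X)
    (ht : ∀ p, dirD t Φ p = 0) (ha : ContDiff ℝ ∞ a) (p : X) :
    (vecD c d v w (fun p => vecD c' d' v' w' a p + -s * vecD c' d' v' w' Φ p * dirD t a p) p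
        + s * vecD c d v w Φ p *
          dirD t (fun p => vecD c' d' v' w' a p + -s * vecD c' d' v' w' Φ p * dirD t a p) p)
      - (vecD c' d' v' w' (fun p => vecD c d v w a p + s * vecD c d v w Φ p * dirD t a p) p
        + -s * vecD c' d' v' w' Φ p *
          dirD t (fun p => vecD c d v w a p + s * vecD c d v w Φ p * dirD t a p) p)
      = -2 * s * vecD c d v w (vecD c' d' v' w' Φ) p * dirD t a p := by
  have hcross : ∀ (r : ℂ) (c d c' d' : ℂ) (v w v' w' : X),
      vecD c d v w (fun p => vecD c' d' v' w' a p + r * vecD c' d' v' w' Φ p * dirD t a p) p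
      = vecD c d v w (vecD c' d' v' w' a) p
        + r * (vecD c d v w (vecD c' d' v' w' Φ) p * dirD t a p
          + vecD c' d' v' w' Φ p * vecD c d v w (dirD t a) p) := by
    intro r c d c' d' v w v' w'
    have h1 := contDiff_vecD c' d' v' w' ha
    have h2 := contDiff_vecD c' d' v' w' hΦ
    have h3 := contDiff_dirD ha t
    rw [vecD_add _ _ _ _ h1 ((contDiff_const.mul h2).mul h3),
      vecD_mul _ _ _ _ (contDiff_const.mul h2) h3, vecD_mul _ _ _ _ contDiff_const h2]
    simp [vecD, dirD]
    ring
  have htz : dirD t Φ = fun _ => 0 := funext ht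
  have hT : ∀ (c d : ℂ) (v w : X) (b : X → ℂ), ContDiff ℝ ∞ b →
      vecD 1 0 t t (vecD c d v w b) p = vecD c d v w (dirD t b) p := fun c d v w b hb => by
    rw [vecD_comm _ _ _ _ _ _ _ _ hb, vecD_one_zero]
  have hz : ∀ (c d : ℂ) (v w : X), vecD c d v w (dirD t Φ) p = 0 := fun c d v w => by
    rw [htz]; simp [vecD, dirD]
  simp only [← vecD_one_zero t t (fun p => _ + _), hcross, hT _ _ _ _ _ ha, hT _ _ _ _ _ hΦ, hz]
  rw [vecD_comm c' d' c d v' w' v w ha, vecD_comm c' d' c d v' w' v w hΦ, vecD_one_zero]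
  ring

end Commutator

section Heisenberg

open ComplexConjugate
open scoped ContDiff

variable {n : ℕ}

/-- A weight on `ℂⁿ` regarded as a complex function on `ℂⁿ × ℝ`. -/
noncomputable def weightLift (φ : (Fin n → ℂ) → ℝ) (p : (Fin n → ℂ) × ℝ) : ℂ := (φ p.1 : ℂ)

/-- The holomorphic Wirtinger derivative on `ℂⁿ × ℝ`. -/
noncomputable def wirtD (j : Fin n) (a : (Fin n → ℂ) × ℝ → ℂ) : (Fin n → ℂ) × ℝ → ℂ :=
  vecD (1 / 2) (-(Complex.I / 2)) (Pi.single j 1, 0) (Pi.single j Complex.I, 0) a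

/-- The antiholomorphic Wirtinger derivative on `ℂⁿ × ℝ`. -/
noncomputable def wirtDbar (j : Fin n) (a : (Fin n → ℂ) × ℝ → ℂ) : (Fin n → ℂ) × ℝ → ℂ :=
  vecD (1 / 2) (Complex.I / 2) (Pi.single j 1, 0) (Pi.single j Complex.I, 0) a

variable {φ : (Fin n → ℂ) → ℝ} {a b : (Fin n → ℂ) × ℝ → ℂ}

theorem contDiff_weightLift (hφ : ContDiff ℝ ∞ φ) : ContDiff ℝ ∞ (weightLift φ) :=
  Complex.ofRealCLM.contDiff.comp (hφ.comp contDiff_fst)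

theorem lineDeriv_slice (ha : ContDiff ℝ ∞ a) (z v : Fin n → ℂ) (x : ℝ) :
    lineDeriv ℝ (fun w => a (w, x)) z v = dirD (v, 0) a (z, x) := by
  have h1 : HasFDerivAt a (fderiv ℝ a (z, x)) (z, x) :=
    (ha.differentiable (by simp) _).hasFDerivAt
  have h2 := (h1.hasLineDerivAt (v, 0)).lineDeriv
  simpa [lineDeriv, dirD] using h2

theorem wirtZ_slice (ha : ContDiff ℝ ∞ a) (j : Fin n) (z : Fin n → ℂ) (x : ℝ) :
    wirtZ (fun w => a (w, x)) j z = wirtD j a (z, x) := by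
  simp only [wirtZ, lineDeriv_slice ha, wirtD, vecD]
  ring

theorem wirtZbar_slice (ha : ContDiff ℝ ∞ a) (j : Fin n) (z : Fin n → ℂ) (x : ℝ) :
    wirtZbar (fun w => a (w, x)) j z = wirtDbar j a (z, x) := by
  simp only [wirtZbar, lineDeriv_slice ha, wirtDbar, vecD]
  ring

theorem wirtZR_eq (hφ : ContDiff ℝ ∞ φ) (j : Fin n) (z : Fin n → ℂ) (x : ℝ) :
    wirtZR φ j z = wirtD j (weightLift φ) (z, x) :=
  wirtZ_slice (contDiff_weightLift hφ) j z x

theorem wirtZbarR_eq (hφ : ContDiff ℝ ∞ φ) (j : Fin n) (z : Fin n → ℂ) (x : ℝ) :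
    wirtZbarR φ j z = wirtDbar j (weightLift φ) (z, x) :=
  wirtZbar_slice (contDiff_weightLift hφ) j z x

theorem leviForm_eq (hφ : ContDiff ℝ ∞ φ) (j k : Fin n) (z : Fin n → ℂ) (x : ℝ) :
    leviForm φ j k z = wirtD j (wirtDbar k (weightLift φ)) (z, x) := by
  have h : (fun w => wirtZbarR φ k w) = fun w => wirtDbar k (weightLift φ) (w, x) :=
    funext fun w => wirtZbarR_eq hφ k w x
  rw [leviForm, h]
  exact wirtZ_slice (contDiff_vecD _ _ _ _ (contDiff_weightLift hφ)) j z x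

theorem contDiff_leviForm (hφ : ContDiff ℝ ∞ φ) (j k : Fin n) :
    ContDiff ℝ ∞ fun p : (Fin n → ℂ) × ℝ => leviForm φ j k p.1 := by
  have h : (fun p : (Fin n → ℂ) × ℝ => leviForm φ j k p.1)
      = wirtD j (wirtDbar k (weightLift φ)) := funext fun p => leviForm_eq hφ j k p.1 p.2
  rw [h]
  exact contDiff_vecD _ _ _ _ (contDiff_vecD _ _ _ _ (contDiff_weightLift hφ))

theorem conj_wirtZR (hφ : ContDiff ℝ ∞ φ) (j : Fin n) (z : Fin n → ℂ) :
    conj (wirtZR φ j z) = wirtZbarR φ j z := by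
  have h : ∀ v, conj (dirD ((v, 0) : (Fin n → ℂ) × ℝ) (weightLift φ) (z, 0))
      = dirD ((v, 0) : (Fin n → ℂ) × ℝ) (weightLift φ) (z, 0) := by
    intro v
    have h1 : HasFDerivAt (fun p : (Fin n → ℂ) × ℝ => φ p.1)
        (fderiv ℝ (fun p : (Fin n → ℂ) × ℝ => φ p.1) (z, 0)) (z, 0) :=
      ((hφ.comp contDiff_fst).differentiable (by simp) _).hasFDerivAt
    have h2 := (Complex.ofRealCLM.hasFDerivAt.comp _ h1).fderiv
    have h3 : dirD ((v, 0) : (Fin n → ℂ) × ℝ) (weightLift φ) (z, 0)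
        = ((fderiv ℝ (fun p : (Fin n → ℂ) × ℝ => φ p.1) (z, 0) (v, 0) : ℝ) : ℂ) :=
      congrArg (fun L : (Fin n → ℂ) × ℝ →L[ℝ] ℂ => L (v, 0)) h2
    rw [h3, Complex.conj_ofReal]
  rw [wirtZR_eq hφ j z 0, wirtZbarR_eq hφ j z 0]
  simp only [wirtD, wirtDbar, vecD, map_add, map_mul, map_div₀, map_neg, map_one, map_ofNat,
    Complex.conj_I, h]
  ring

theorem dX_eq (ha : ContDiff ℝ ∞ a) : dX a = dirD (0, 1) a :=
  funext fun p => (dirD_snd ha p.1 p.2).symm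

theorem Zbar_eq (hφ : ContDiff ℝ ∞ φ) (ha : ContDiff ℝ ∞ a) (j : Fin n) :
    Zbar φ j a = fun p =>
      wirtDbar j a p + -Complex.I * wirtDbar j (weightLift φ) p * dirD (0, 1) a p := by
  funext p
  rw [Zbar, wirtZbar_slice ha, wirtZbarR_eq hφ j p.1 p.2, dX_eq ha]
  ring

theorem Zorig_eq (hφ : ContDiff ℝ ∞ φ) (ha : ContDiff ℝ ∞ a) (j : Fin n) :
    Zorig φ j a = fun p =>
      wirtD j a p + Complex.I * wirtD j (weightLift φ) p * dirD (0, 1) a p := by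
  funext p
  rw [Zorig, wirtZ_slice ha, wirtZR_eq hφ j p.1 p.2, dX_eq ha]

theorem IsTest.vecD {X : Type*} [NormedAddCommGroup X] [NormedSpace ℝ X] {a : X → ℂ}
    (ha : IsTest a) (c d : ℂ) (v w : X) : IsTest (vecD c d v w a) :=
  ((ha.dirD v).const_mul c).add ((ha.dirD w).const_mul d)

theorem IsTest.Zbar (hφ : ContDiff ℝ ∞ φ) (ha : IsTest a) (j : Fin n) : IsTest (Zbar φ j a) := by
  rw [Zbar_eq hφ ha.1]
  exact (ha.vecD _ _ _ _).add ((ha.dirD _).smooth_mul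
    (contDiff_const.mul (contDiff_vecD _ _ _ _ (contDiff_weightLift hφ))))

theorem IsTest.Zorig (hφ : ContDiff ℝ ∞ φ) (ha : IsTest a) (j : Fin n) :
    IsTest (Zorig φ j a) := by
  rw [Zorig_eq hφ ha.1]
  exact (ha.vecD _ _ _ _).add ((ha.dirD _).smooth_mul
    (contDiff_const.mul (contDiff_vecD _ _ _ _ (contDiff_weightLift hφ))))

/-- The commutation relation `[Z_j, Z̄_k] = -2i (∂²φ/∂z_j∂z̄_k) ∂/∂x`. -/
theorem commutator_Zorig_Zbar (hφ : ContDiff ℝ ∞ φ) (ha : IsTest a) (j k : Fin n)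
    (p : (Fin n → ℂ) × ℝ) :
    Zorig φ j (Zbar φ k a) p - Zbar φ k (Zorig φ j a) p
      = -2 * Complex.I * (leviForm φ j k p.1 * dirD (0, 1) a p) := by
  have ht : ∀ p, dirD ((0, 1) : (Fin n → ℂ) × ℝ) (weightLift φ) p = 0 := fun p => by
    rw [dirD_snd (contDiff_weightLift hφ)]
    simp [weightLift]
  rw [Zorig_eq hφ (ha.Zbar hφ k).1, Zbar_eq hφ (ha.Zorig hφ j).1, Zbar_eq hφ ha.1,
    Zorig_eq hφ ha.1, leviForm_eq hφ j k p.1 p.2, ← mul_assoc]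
  exact commutator_vecD _ _ _ _ _ _ _ _ Complex.I (contDiff_weightLift hφ) (0, 1) ht ha.1 p

theorem freqInner_vecD_fst (ha : IsTest a) (hb : IsTest b) (ξ : ℝ) (c d : ℂ)
    (v w : Fin n → ℂ) :
    freqInner ξ (vecD c d ((v, 0) : (Fin n → ℂ) × ℝ) (w, 0) a) b
      = -freqInner ξ a (vecD (conj c) (conj d) ((v, 0) : (Fin n → ℂ) × ℝ) (w, 0) b) := by
  have h : ∀ (c d : ℂ) {a b : (Fin n → ℂ) × ℝ → ℂ}, IsTest a → IsTest b →
      freqInner ξ (vecD c d ((v, 0) : (Fin n → ℂ) × ℝ) (w, 0) a) b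
        = c * freqInner ξ (dirD ((v, 0) : (Fin n → ℂ) × ℝ) a) b
          + d * freqInner ξ (dirD ((w, 0) : (Fin n → ℂ) × ℝ) a) b := by
    intro c d a b ha hb
    unfold vecD
    rw [freqInner_add_left ((ha.dirD _).const_mul c) ((ha.dirD _).const_mul d) hb,
      freqInner_const_mul_left, freqInner_const_mul_left]
  rw [h c d ha hb, ← freqInner_conj _ a, h _ _ hb ha]
  simp only [map_add, map_mul, Complex.conj_conj, freqInner_conj, freqInner_dirD_fst ha hb]
  ring

theorem freqInner_fst_mul_dirD (ha : IsTest a) (g : (Fin n → ℂ) → ℂ)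
    (b : (Fin n → ℂ) × ℝ → ℂ) (ξ : ℝ) :
    freqInner ξ (fun p => g p.1 * dirD (0, 1) a p) b
      = 2 * Real.pi * Complex.I * ξ * freqInner ξ (fun p => g p.1 * a p) b := by
  rw [freqInner_fst_mul_left g, freqInner_dirD_snd_left ha, freqInner_fst_mul_left g]

/-- `-Z_j` is the formal adjoint of `Z̄_j`, at each frequency. -/
theorem freqInner_Zbar (hφ : ContDiff ℝ ∞ φ) (ha : IsTest a) (hb : IsTest b) (ξ : ℝ)
    (j : Fin n) : freqInner ξ (Zbar φ j a) b = -freqInner ξ a (Zorig φ j b) := by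
  have hg : ∀ p : (Fin n → ℂ) × ℝ,
      -Complex.I * wirtDbar j (weightLift φ) p = -Complex.I * wirtZbarR φ j p.1 := fun p => by
    rw [wirtZbarR_eq hφ j p.1 p.2]
  have hg' : ∀ p : (Fin n → ℂ) × ℝ,
      Complex.I * wirtD j (weightLift φ) p = Complex.I * wirtZR φ j p.1 := fun p => by
    rw [wirtZR_eq hφ j p.1 p.2]
  have hW := contDiff_vecD (1 / 2) (-(Complex.I / 2)) ((Pi.single j 1, 0) : (Fin n → ℂ) × ℝ)
    (Pi.single j Complex.I, 0) (contDiff_weightLift hφ)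
  have hWb := contDiff_vecD (1 / 2) (Complex.I / 2) ((Pi.single j 1, 0) : (Fin n → ℂ) × ℝ)
    (Pi.single j Complex.I, 0) (contDiff_weightLift hφ)
  have h1 : IsTest fun p => -Complex.I * wirtDbar j (weightLift φ) p * dirD (0, 1) a p :=
    (ha.dirD _).smooth_mul (contDiff_const.mul hWb)
  have h2 : IsTest fun p => Complex.I * wirtD j (weightLift φ) p * dirD (0, 1) b p :=
    (hb.dirD _).smooth_mul (contDiff_const.mul hW)
  have h3 : IsTest (wirtDbar j a) := ha.vecD _ _ _ _
  have h4 : IsTest (wirtD j b) := hb.vecD _ _ _ _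
  have h5 : freqInner ξ (wirtDbar j a) b = -freqInner ξ a (wirtD j b) := by
    rw [wirtDbar, freqInner_vecD_fst ha hb, wirtD]
    simp only [map_div₀, map_one, map_ofNat, Complex.conj_I, neg_div]
  have h6 : freqInner ξ (fun p => -Complex.I * wirtZbarR φ j p.1 * dirD (0, 1) a p) b
      = -freqInner ξ a (fun p => Complex.I * wirtZR φ j p.1 * dirD (0, 1) b p) := by
    rw [freqInner_fst_mul_dirD ha (fun z => -Complex.I * wirtZbarR φ j z),
      ← freqInner_conj _ a, freqInner_fst_mul_dirD hb (fun z => Complex.I * wirtZR φ j z),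
      freqInner_fst_mul_left (fun z => -Complex.I * wirtZbarR φ j z)]
    simp only [← conj_wirtZR hφ, map_mul, map_neg, Complex.conj_I, Complex.conj_conj,
      Complex.conj_ofReal, freqInner_conj, map_ofNat, neg_neg]
    ring
  rw [Zbar_eq hφ ha.1, Zorig_eq hφ hb.1, freqInner_add_left h3 h1 hb,
    ← freqInner_conj _ a, freqInner_add_left h4 h2 ha, map_add, freqInner_conj,
    freqInner_conj, h5]
  simp only [hg, hg', h6]
  ring

/-- `-Z̄_j` is the formal adjoint of `Z_j`, at each frequency. -/
theorem freqInner_Zorig (hφ : ContDiff ℝ ∞ φ) (ha : IsTest a) (hb : IsTest b) (ξ : ℝ)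
    (j : Fin n) : freqInner ξ (Zorig φ j a) b = -freqInner ξ a (Zbar φ j b) := by
  rw [← freqInner_conj, ← freqInner_conj _ a, freqInner_Zbar hφ hb ha, map_neg, neg_neg]

end Heisenberg

section Forms

open ComplexConjugate
open scoped ContDiff

variable {n m : ℕ} {φ : (Fin n → ℂ) → ℝ} {a : (Fin n → ℂ) × ℝ → ℂ}

theorem Zbar_const_mul (hφ : ContDiff ℝ ∞ φ) (ha : ContDiff ℝ ∞ a) (c : ℂ) (j : Fin n)
    (p : (Fin n → ℂ) × ℝ) : Zbar φ j (fun p => c * a p) p = c * Zbar φ j a p := by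
  rw [Zbar_eq hφ (contDiff_const.mul ha), Zbar_eq hφ ha]
  simp only [wirtDbar, vecD, dirD_const_mul ha]
  ring

theorem Zorig_const_mul (hφ : ContDiff ℝ ∞ φ) (ha : ContDiff ℝ ∞ a) (c : ℂ) (j : Fin n)
    (p : (Fin n → ℂ) × ℝ) : Zorig φ j (fun p => c * a p) p = c * Zorig φ j a p := by
  rw [Zorig_eq hφ (contDiff_const.mul ha), Zorig_eq hφ ha]
  simp only [wirtD, vecD, dirD_const_mul ha]
  ring

theorem IsSkew.cons_left {ι : Type*} {c : (Fin (m + 1) → ι) → ℂ} (hc : IsSkew c) (j : ι) :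
    IsSkew fun I => c (Fin.cons j I) := by
  intro σ I
  have h : (Fin.cons j (I ∘ σ) : Fin (m + 1) → ι)
      = Fin.cons j I ∘ Equiv.Perm.decomposeFin.symm (0, σ) := by
    funext i
    refine Fin.cases ?_ (fun i => ?_) i <;> simp
  simp only [h]
  rw [hc, Equiv.Perm.decomposeFin.symm_sign]
  simp

/-- A skew-symmetric family of test functions, i.e. a test `(0,m)`-form. -/
structure IsTestForm (w : (Fin m → Fin n) → ((Fin n → ℂ) × ℝ → ℂ)) : Prop where
  isTest : ∀ J, IsTest (w J)
  isSkew : ∀ p, IsSkew fun J => w J p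

namespace IsTestForm

variable {w : (Fin m → Fin n) → ((Fin n → ℂ) × ℝ → ℂ)}

theorem comp_perm (hw : IsTestForm w) (σ : Equiv.Perm (Fin m)) (J : Fin m → Fin n) :
    w (J ∘ σ) = fun p => ((Equiv.Perm.sign σ : ℤ) : ℂ) * w J p :=
  funext fun p => hw.isSkew p σ J

theorem isSkew_ftx (hw : IsTestForm w) (ξ : ℝ) (z : Fin n → ℂ) :
    IsSkew fun J => ftx ξ (w J) z := by
  intro σ J
  simp only [hw.comp_perm]
  exact ftx_const_mul _ _ _ _

open Classical in
theorem sum_freqInner (hw : IsTestForm w) (ξ : ℝ) :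
    ∑ J, freqInner ξ (w J) (w J)
      = (m.factorial : ℂ) * ∑ J, if StrictMono J then freqInner ξ (w J) (w J) else 0 := by
  refine sum_eq_factorial_mul_sum_strictMono (g := fun J => freqInner ξ (w J) (w J))
    (fun σ J => ?_) fun J hJ => ?_
  · unfold freqInner
    congr 1 with z
    exact (hw.isSkew_ftx ξ z).conj_mul (hw.isSkew_ftx ξ z) σ J
  · simp [freqInner, (hw.isSkew_ftx ξ _).eq_zero_of_not_injective hJ]

theorem Zbar (hφ : ContDiff ℝ ∞ φ) (hw : IsTestForm w) (j : Fin n) :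
    IsTestForm fun J => Zbar φ j (w J) := by
  refine ⟨fun J => (hw.isTest J).Zbar hφ j, fun p σ J => ?_⟩
  simp only [hw.comp_perm]
  exact Zbar_const_mul hφ (hw.isTest J).1 _ j p

theorem Zorig (hφ : ContDiff ℝ ∞ φ) (hw : IsTestForm w) (j : Fin n) :
    IsTestForm fun J => Zorig φ j (w J) := by
  refine ⟨fun J => (hw.isTest J).Zorig hφ j, fun p σ J => ?_⟩
  simp only [hw.comp_perm]
  exact Zorig_const_mul hφ (hw.isTest J).1 _ j p

theorem dbarb (hφ : ContDiff ℝ ∞ φ) (hw : IsTestForm w) : IsTestForm (dbarb φ w) where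
  isTest K := IsTest.sum _ fun k => ((hw.isTest _).Zbar hφ (K k)).const_mul _
  isSkew p := isSkew_wedgeSum fun j => (hw.Zbar hφ j).isSkew p

theorem dbarbAdj {w : (Fin (m + 1) → Fin n) → ((Fin n → ℂ) × ℝ → ℂ)}
    (hφ : ContDiff ℝ ∞ φ) (hw : IsTestForm w) : IsTestForm (dbarbAdj φ w) where
  isTest I := by
    have h := (IsTest.sum Finset.univ fun j =>
      (hw.isTest (Fin.cons j I)).Zorig hφ j).const_mul (-1)
    simp only [neg_one_mul] at h
    exact h
  isSkew p σ I := by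
    simp only [_root_.dbarbAdj, mul_neg, Finset.mul_sum]
    exact congrArg Neg.neg (Finset.sum_congr rfl fun j _ =>
      ((hw.Zorig hφ j).isSkew p).cons_left j σ I)

end IsTestForm

theorem freqInner_neg_sum {f : Fin n → (Fin n → ℂ) × ℝ → ℂ} (hf : ∀ j, IsTest (f j)) (ξ : ℝ) :
    freqInner ξ (fun p => -∑ j, f j p) (fun p => -∑ j, f j p)
      = ∑ j, ∑ l, freqInner ξ (f j) (f l) := by
  have h : ∀ z, ftx ξ (fun p => -∑ j, f j p) z = -∑ j, ftx ξ (f j) z := fun z => by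
    simpa only [neg_one_mul, ftx_sum _ hf] using ftx_const_mul (-1) (fun p => ∑ j, f j p) ξ z
  simp only [freqInner, h, map_neg, neg_mul_neg, map_sum, Finset.sum_mul_sum]
  rw [integral_finsetSum _ fun j _ => integrable_finsetSum _ fun l _ =>
    integrable_ftx_mul_conj (hf j) (hf l) ξ]
  exact Finset.sum_congr rfl fun j _ => integral_finsetSum _ fun l _ =>
    integrable_ftx_mul_conj (hf j) (hf l) ξ

variable {w : (Fin (m + 1) → Fin n) → ((Fin n → ℂ) × ℝ → ℂ)}

theorem sum_freqInner_dbarb (hφ : ContDiff ℝ ∞ φ) (hw : IsTestForm w) (ξ : ℝ) :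
    ∑ K, freqInner ξ (dbarb φ w K) (dbarb φ w K)
      = (m + 2) * (∑ j, ∑ J, freqInner ξ (Zbar φ j (w J)) (Zbar φ j (w J))
        - (m + 1) * ∑ I : Fin m → Fin n, ∑ j, ∑ l,
          freqInner ξ (Zbar φ j (w (Fin.cons l I))) (Zbar φ l (w (Fin.cons j I)))) := by
  have hZ : ∀ j J, IsTest (Zbar φ j (w J)) := fun j J => (hw.isTest J).Zbar hφ j
  have hi : ∀ j J l L, Integrable fun z =>
      ftx ξ (Zbar φ j (w J)) z * conj (ftx ξ (Zbar φ l (w L)) z) := fun j J l L =>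
    integrable_ftx_mul_conj (hZ j J) (hZ l L) ξ
  have h1 : ∀ K z, ftx ξ (dbarb φ w K) z = wedgeSum (fun j J => ftx ξ (Zbar φ j (w J)) z) K :=
    fun K z => by
      refine (ftx_sum _ (fun k => (hZ _ _).const_mul _) ξ z).trans ?_
      simp only [ftx_const_mul]
      rfl
  have h2 := congrArg (fun F : (Fin n → ℂ) → ℂ => ∫ z, F z) (funext fun z =>
    sum_wedgeSum_sq fun j => (hw.Zbar hφ j).isSkew_ftx ξ z)
  simp only [← h1] at h2
  rw [integral_finsetSum _ fun K _ =>
      integrable_ftx_mul_conj ((hw.dbarb hφ).isTest K) ((hw.dbarb hφ).isTest K) ξ,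
    integral_const_mul, integral_sub, integral_const_mul,
    integral_finsetSum _ fun j _ => integrable_finsetSum _ fun J _ => hi _ _ _ _,
    integral_finsetSum _ fun I _ => integrable_finsetSum _ fun j _ =>
      integrable_finsetSum _ fun l _ => hi _ _ _ _] at h2
  · simp only [freqInner]
    rw [h2]
    congr 3
    · funext j
      exact integral_finsetSum _ fun J _ => hi _ _ _ _
    · refine Finset.sum_congr rfl fun I _ => ?_
      rw [integral_finsetSum _ fun j _ => integrable_finsetSum _ fun l _ => hi _ _ _ _]
      exact Finset.sum_congr rfl fun j _ => integral_finsetSum _ fun l _ => hi _ _ _ _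
  · exact integrable_finsetSum _ fun j _ => integrable_finsetSum _ fun J _ => hi _ _ _ _
  · exact (integrable_finsetSum _ fun I _ => integrable_finsetSum _ fun j _ =>
      integrable_finsetSum _ fun l _ => hi _ _ _ _).const_mul _

/-- The commutator term of the Bochner–Kodaira–Nakano identity, at each frequency. -/
theorem sum_freqInner_dbarbAdj (hφ : ContDiff ℝ ∞ φ) (hw : IsTestForm w) (ξ : ℝ) :
    ∑ I, freqInner ξ (dbarbAdj φ w I) (dbarbAdj φ w I)
      = ∑ I : Fin m → Fin n, ∑ j, ∑ l,
          freqInner ξ (Zbar φ j (w (Fin.cons l I))) (Zbar φ l (w (Fin.cons j I)))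
        + 4 * Real.pi * ξ * ∑ I : Fin m → Fin n, ∑ j, ∑ l,
          freqInner ξ (fun p => leviForm φ j l p.1 * w (Fin.cons j I) p) (w (Fin.cons l I)) := by
  rw [Finset.mul_sum, ← Finset.sum_add_distrib]
  refine Finset.sum_congr rfl fun I _ => ?_
  have hu : ∀ j, IsTest (w (Fin.cons j I)) := fun j => hw.isTest _
  refine (freqInner_neg_sum (fun j => (hu j).Zorig hφ j) ξ).trans ?_
  rw [Finset.sum_comm (f := fun j l =>
    freqInner ξ (Zbar φ j (w (Fin.cons l I))) (Zbar φ l (w (Fin.cons j I)))), Finset.mul_sum,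
    ← Finset.sum_add_distrib]
  refine Finset.sum_congr rfl fun j _ => ?_
  rw [Finset.mul_sum, ← Finset.sum_add_distrib]
  refine Finset.sum_congr rfl fun l _ => ?_
  have hZb := (hu j).Zbar hφ l
  have hZo := (hu j).Zorig hφ j
  have h1 := freqInner_Zbar hφ hZo (hu l) ξ l
  have h2 := freqInner_Zorig hφ hZb (hu l) ξ j
  have hL : IsTest fun p =>
      -2 * Complex.I * (leviForm φ j l p.1 * dirD (0, 1) (w (Fin.cons j I)) p) :=
    (((hu j).dirD _).smooth_mul (contDiff_leviForm hφ j l)).const_mul _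
  have h3 : Zorig φ j (Zbar φ l (w (Fin.cons j I))) = fun p =>
      Zbar φ l (Zorig φ j (w (Fin.cons j I))) p
        + -2 * Complex.I * (leviForm φ j l p.1 * dirD (0, 1) (w (Fin.cons j I)) p) :=
    funext fun p => by rw [← commutator_Zorig_Zbar hφ (hu j)]; ring
  rw [h3, freqInner_add_left (hZo.Zbar hφ l) hL (hu l), freqInner_const_mul_left,
    freqInner_fst_mul_dirD (hu j)] at h2
  linear_combination h1 - h2
    - 4 * Real.pi * ξ * freqInner ξ (fun p => leviForm φ j l p.1 * w (Fin.cons j I) p)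
      (w (Fin.cons l I)) * Complex.I_sq

theorem le_re_sum_freqInner_leviForm (hφ : ContDiff ℝ ∞ φ) {ε : ℝ}
    (hLevi : ∀ (z : Fin n → ℂ) (ξ : Fin n → ℂ), ε * ∑ j, ‖ξ j‖ ^ 2 ≤
        (∑ j, ∑ k, leviForm φ j k z * ξ j * conj (ξ k)).re)
    {f : Fin n → (Fin n → ℂ) × ℝ → ℂ} (hf : ∀ j, IsTest (f j)) (ξ : ℝ) :
    ε * ∑ j, (freqInner ξ (f j) (f j)).re
      ≤ (∑ j, ∑ l, freqInner ξ (fun p => leviForm φ j l p.1 * f j p) (f l)).re := by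
  have hi : ∀ j l, Integrable fun z =>
      leviForm φ j l z * ftx ξ (f j) z * conj (ftx ξ (f l) z) := fun j l => by
    simpa only [ftx_fst_mul] using
      integrable_ftx_mul_conj ((hf j).smooth_mul (contDiff_leviForm hφ j l)) (hf l) ξ
  have hs : Integrable fun z => ∑ j, ∑ l, leviForm φ j l z * ftx ξ (f j) z * conj (ftx ξ (f l) z) :=
    integrable_finsetSum _ fun j _ => integrable_finsetSum _ fun l _ => hi j l
  have hn : ∀ j, Integrable fun z => (ftx ξ (f j) z * conj (ftx ξ (f j) z)).re := fun j =>
    (integrable_ftx_mul_conj (hf j) (hf j) ξ).re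
  have h1 : (∑ j, ∑ l, freqInner ξ (fun p => leviForm φ j l p.1 * f j p) (f l)).re
      = ∫ z, (∑ j, ∑ l, leviForm φ j l z * ftx ξ (f j) z * conj (ftx ξ (f l) z)).re := by
    refine Eq.trans (congrArg Complex.re ?_) (integral_re hs).symm
    rw [integral_finsetSum _ fun j _ => integrable_finsetSum _ fun l _ => hi j l]
    refine Finset.sum_congr rfl fun j _ => ?_
    rw [integral_finsetSum _ fun l _ => hi j l]
    refine Finset.sum_congr rfl fun l _ => ?_
    simp only [freqInner, ftx_fst_mul]
  have h2 : ε * ∑ j, (freqInner ξ (f j) (f j)).re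
      = ∫ z, ε * ∑ j, (ftx ξ (f j) z * conj (ftx ξ (f j) z)).re := by
    rw [integral_const_mul, integral_finsetSum _ fun j _ => hn j]
    refine congrArg _ (Finset.sum_congr rfl fun j _ => ?_)
    exact (integral_re (integrable_ftx_mul_conj (hf j) (hf j) ξ)).symm
  rw [h1, h2]
  refine integral_mono ((integrable_finsetSum _ fun j _ => hn j).const_mul ε) hs.re fun z => ?_
  have h := hLevi z fun j => ftx ξ (f j) z
  simpa only [Complex.mul_conj, Complex.normSq_eq_norm_sq, Complex.ofReal_re] using h

open Classical in
theorem re_sum_freqInner_le (hφ : ContDiff ℝ ∞ φ) {ε : ℝ} (hε : 0 < ε)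
    (hLevi : ∀ (z : Fin n → ℂ) (ξ : Fin n → ℂ), ε * ∑ j, ‖ξ j‖ ^ 2 ≤
        (∑ j, ∑ k, leviForm φ j k z * ξ j * conj (ξ k)).re)
    (hw : IsTestForm w) (ξ : ℝ) :
    4 * Real.pi * ξ * ε * (m + 1) *
        (∑ J, if StrictMono J then freqInner ξ (w J) (w J) else 0).re
      ≤ (∑ K, if StrictMono K then freqInner ξ (dbarb φ w K) (dbarb φ w K) else 0).re
        + (∑ I, if StrictMono I then
            freqInner ξ (dbarbAdj φ w I) (dbarbAdj φ w I) else 0).re := by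
  have hnonneg : ∀ {k : ℕ} (v : (Fin k → Fin n) → ((Fin n → ℂ) × ℝ → ℂ)),
      0 ≤ (∑ J, if StrictMono J then freqInner ξ (v J) (v J) else 0).re := fun v => by
    rw [Complex.re_sum]
    refine Finset.sum_nonneg fun J _ => ?_
    split_ifs
    exacts [freqInner_self_re_nonneg _ _, le_rfl]
  rcases le_or_gt ξ 0 with hξ | hξ
  · have h : 4 * Real.pi * ξ * ε * (m + 1) ≤ 0 := by
      have : 0 ≤ 4 * Real.pi * (-ξ) * ε * (m + 1) := by
        have := neg_nonneg.mpr hξ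
        positivity
      linarith
    exact (mul_nonpos_of_nonpos_of_nonneg h (hnonneg w)).trans
      (add_nonneg (hnonneg _) (hnonneg _))
  have h0 := congrArg Complex.re (hw.sum_freqInner ξ)
  have h1 := (hw.dbarb hφ).sum_freqInner ξ
  have h2 := (hw.dbarbAdj hφ).sum_freqInner ξ
  rw [sum_freqInner_dbarb hφ hw] at h1
  rw [sum_freqInner_dbarbAdj hφ hw] at h2
  rw [sum_cons, Finset.sum_comm, Complex.re_sum] at h0
  have hL : ∀ I : Fin m → Fin n, _ := fun I =>
    le_re_sum_freqInner_leviForm hφ hLevi (fun j => hw.isTest (Fin.cons j I)) ξ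
  have hL' := Finset.sum_le_sum fun I (_ : I ∈ Finset.univ) => hL I
  rw [← Finset.mul_sum, ← Complex.re_sum] at hL'
  have hP : 0 ≤ (∑ j, ∑ J, freqInner ξ (Zbar φ j (w J)) (Zbar φ j (w J))).re := by
    simp only [Complex.re_sum]
    exact Finset.sum_nonneg fun j _ => Finset.sum_nonneg fun J _ => freqInner_self_re_nonneg _ _
  simp only [← Complex.re_sum] at h0 hL'
  set S0 := ∑ J, if StrictMono J then freqInner ξ (w J) (w J) else 0
  set S1 := ∑ K, if StrictMono K then freqInner ξ (dbarb φ w K) (dbarb φ w K) else 0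
  set S2 := ∑ I, if StrictMono I then freqInner ξ (dbarbAdj φ w I) (dbarbAdj φ w I) else 0
  set P := ∑ j, ∑ J, freqInner ξ (Zbar φ j (w J)) (Zbar φ j (w J))
  set Q := ∑ I : Fin m → Fin n, ∑ j, ∑ l,
    freqInner ξ (Zbar φ j (w (Fin.cons l I))) (Zbar φ l (w (Fin.cons j I)))
  set L := ∑ I : Fin m → Fin n, ∑ j, ∑ l,
    freqInner ξ (fun p => leviForm φ j l p.1 * w (Fin.cons j I) p) (w (Fin.cons l I))
  have hsum : ((m + 1).factorial : ℂ) * (S1 + S2) = P + ((m + 1) * (4 * Real.pi * ξ) : ℝ) * L := by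
    have hm : (m + 2 : ℂ) ≠ 0 := by exact_mod_cast (by omega : m + 2 ≠ 0)
    apply mul_left_cancel₀ hm
    push_cast [Nat.factorial_succ] at h1 h2 ⊢
    linear_combination -h1 - (m + 2) * (m + 1) * h2
  have hre := congrArg Complex.re hsum
  rw [← Complex.ofReal_natCast, Complex.re_ofReal_mul, Complex.add_re, Complex.add_re,
    Complex.re_ofReal_mul] at hre
  rw [← Complex.ofReal_natCast, Complex.re_ofReal_mul] at h0
  rw [h0] at hL'
  have hf : (0 : ℝ) < ((m + 1).factorial : ℕ) := by exact_mod_cast Nat.factorial_pos _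
  refine le_of_mul_le_mul_left ?_ hf
  rw [hre]
  have hc : 0 ≤ (m + 1 : ℝ) * (4 * Real.pi * ξ) := by positivity
  nlinarith [mul_le_mul_of_nonneg_left hL' hc]

end Forms

section Integration

open ComplexConjugate
open scoped ContDiff

variable {n m : ℕ}

open Classical in
theorem integrable_sum_freqInner {f g : (Fin m → Fin n) → ((Fin n → ℂ) × ℝ → ℂ)}
    (hf : ∀ J, IsTest (f J)) (hg : ∀ J, IsTest (g J)) :
    Integrable fun ξ : ℝ => ∑ J, if StrictMono J then freqInner ξ (f J) (g J) else 0 := by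
  refine integrable_finsetSum _ fun J _ => ?_
  split_ifs
  exacts [integrable_freqInner (hf J) (hg J), integrable_zero _ _ _]

open Classical in
theorem integral_sum_freqInner {f g : (Fin m → Fin n) → ((Fin n → ℂ) × ℝ → ℂ)}
    (hf : ∀ J, IsTest (f J)) (hg : ∀ J, IsTest (g J)) :
    ∫ ξ : ℝ, (∑ J, if StrictMono J then freqInner ξ (f J) (g J) else 0).re
      = (∑ J, if StrictMono J then ∫ p, f J p * conj (g J p) else 0).re := by
  refine (integral_re (integrable_sum_freqInner hf hg)).trans (congrArg Complex.re ?_)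
  rw [integral_finsetSum]
  · refine Finset.sum_congr rfl fun J _ => ?_
    split_ifs
    exacts [integral_freqInner (hf J) (hg J), integral_zero _ _]
  · intro J _
    split_ifs
    exacts [integrable_freqInner (hf J) (hg J), integrable_zero _ _ _]

open Classical in
theorem formNormSq_eq_integral {w : (Fin m → Fin n) → ((Fin n → ℂ) × ℝ → ℂ)}
    (hw : ∀ J, IsTest (w J)) :
    formNormSq w
      = ∫ ξ : ℝ, (∑ J, if StrictMono J then freqInner ξ (w J) (w J) else 0).re := by
  rw [integral_sum_freqInner hw hw, formNormSq, Complex.re_sum]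
  refine Finset.sum_congr rfl fun J _ => ?_
  split_ifs
  · simp only [Complex.mul_conj, Complex.normSq_eq_norm_sq]
    rw [integral_complex_ofReal, Complex.ofReal_re]
  · rfl

end Integration

open Classical in
theorem stmt_7 {n q' : ℕ} (hq : q' + 1 ≤ n)
    (φ : (Fin n → ℂ) → ℝ) (hφ : ContDiff ℝ (⊤ : ℕ∞) φ)
    (ε : ℝ) (hε : 0 < ε)
    (hLevi : ∀ (z : Fin n → ℂ) (ξ : Fin n → ℂ),
      ε * ∑ j, ‖ξ j‖ ^ 2 ≤
        (∑ j, ∑ k, leviForm φ j k z * ξ j * (starRingEnd ℂ) (ξ k)).re)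
    (u : (Fin (q' + 1) → Fin n) → ((Fin n → ℂ) × ℝ → ℂ))
    (hu : ∀ J, ContDiff ℝ (⊤ : ℕ∞) (u J) ∧ HasCompactSupport (u J))
    (hskew : ∀ (σ : Equiv.Perm (Fin (q' + 1))) (J : Fin (q' + 1) → Fin n)
      (p : (Fin n → ℂ) × ℝ),
      u (J ∘ σ) p = ((Equiv.Perm.sign σ : ℤ) : ℂ) * u J p) :
    (∑ J : Fin (q' + 1) → Fin n,
        if StrictMono J then
          ∫ p : (Fin n → ℂ) × ℝ, (-Complex.I * dX (u J) p) * (starRingEnd ℂ) (u J p)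
        else 0).re
      ≤ (1 / (2 * (q' + 1 : ℝ) * ε)) *
          (formNormSq (dbarb φ u) + formNormSq (dbarbAdj φ u)) := by
  have hw : IsTestForm u := ⟨hu, fun p σ J => hskew σ J p⟩
  have hT : ∀ J, IsTest fun p => -Complex.I * dX (u J) p := fun J => by
    rw [dX_eq (hu J).1]
    exact ((hw.isTest J).dirD _).const_mul _
  have hfreq : ∀ ξ : ℝ,
      (∑ J, if StrictMono J then
          freqInner ξ (fun p => -Complex.I * dX (u J) p) (u J) else 0).re
        = 2 * Real.pi * ξ * (∑ J, if StrictMono J then freqInner ξ (u J) (u J) else 0).re := by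
    intro ξ
    rw [← Complex.re_ofReal_mul, Finset.mul_sum]
    refine congrArg Complex.re (Finset.sum_congr rfl fun J _ => ?_)
    split_ifs
    · rw [freqInner_const_mul_left, dX_eq (hu J).1, freqInner_dirD_snd_left (hw.isTest J)]
      push_cast
      linear_combination -2 * Real.pi * ξ * freqInner ξ (u J) (u J) * Complex.I_sq
    · simp
  have h1 := (hw.dbarb hφ).isTest
  have h2 := (hw.dbarbAdj hφ).isTest
  have hi1 := (integrable_sum_freqInner h1 h1).re
  have hi2 := (integrable_sum_freqInner h2 h2).re
  simp only [RCLike.re_eq_complex_re] at hi1 hi2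
  rw [← integral_sum_freqInner hT hw.isTest, formNormSq_eq_integral h1,
    formNormSq_eq_integral h2, ← integral_add hi1 hi2, ← integral_const_mul]
  refine integral_mono (integrable_sum_freqInner hT hw.isTest).re
    ((hi1.add hi2).const_mul _) fun ξ => ?_
  have h := re_sum_freqInner_le hφ hε hLevi hw ξ
  have hc : (0 : ℝ) < 2 * (q' + 1) * ε := by positivity
  simp only [hfreq]
  rw [one_div, ← div_eq_inv_mul, le_div_iff₀ hc]
  linarith
end
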